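/- arXiv:2011.01366 — 2 statements merged into one kernel-verified Lean document; each statement's English description precedes it below -/
import Mathlib

section
/- Let G be a finite graph and let χ : V(G) → C be a vertex coloring that is stable with respect to the Color Refinement algorithm. Let T be a tree with vertex set V(T) = C such that for every edge c₁c₂ ∈ E(T) there exist v₁ ∈ χ^{-1}(c₁) and v₂ ∈ χ^{-1}(c₂) with v₁v₂ ∈ E(G). Let m = min_{c∈C} |χ^{-1}(c)| and ℓ = 2·|V_{≤1}(T)| + |V_{≥3}(T)|. Then there are at least ⌊m/ℓ⌋ pairwise vertex-disjoint subtrees of G that agree with T. -/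
/-- A vertex coloring `χ` of `G` is stable with respect to the Color Refinement algorithm:
vertices of equal color have, for each color `c`, equally many neighbors of color `c`. -/
def IsCRStableColoring {V C : Type*} (G : SimpleGraph V) (χ : V → C) : Prop :=
  ∀ v w, χ v = χ w → ∀ c : C,
    {u | G.Adj v u ∧ χ u = c}.ncard = {u | G.Adj w u ∧ χ u = c}.ncard

namespace TreePacking

/-- Well-founded recursion along a measure-decreasing map, phrased existentially. -/
theorem exists_recursive {C X : Type*} (μ : C → ℕ) (base : C → Prop) (next : C → C)
    (hdec : ∀ c, ¬ base c → μ (next c) < μ c) (a : C → X) (g : C → X → X) :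
    ∃ f : C → X, (∀ c, base c → f c = a c) ∧ ∀ c, ¬ base c → f c = g c (f (next c)) := by
  classical
  let F : (c : C) → ((d : C) → μ d < μ c → X) → X := fun c rec =>
    if h : base c then a c else g c (rec (next c) (hdec c h))
  refine ⟨(measure μ).wf.fix F, fun c hc => ?_, fun c hc => ?_⟩
  · rw [WellFounded.fix_eq]; simp [F, hc]
  · rw [WellFounded.fix_eq]; simp [F, hc]

/-- A rooting of a tree: a parent map and a depth function. -/
theorem exists_parent {C : Type*} (T : SimpleGraph C) (hT : T.IsTree) (r : C) :
    ∃ (p : C → C) (depth : C → ℕ), (∀ c, c ≠ r → depth (p c) < depth c) ∧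
      (∀ c, c ≠ r → T.Adj c (p c)) ∧
      ∀ c d, T.Adj c d → (c ≠ r ∧ p c = d) ∨ (d ≠ r ∧ p d = c) := by
  classical
  have key : ∀ c d d', T.Adj c d → T.Adj c d' → T.dist d r + 1 = T.dist c r →
      T.dist d' r + 1 = T.dist c r → d = d' := by
    intro c d d' h h' hd hd'
    obtain ⟨q, hq⟩ := hT.1.exists_walk_length_eq_dist d r
    obtain ⟨q', hq'⟩ := hT.1.exists_walk_length_eq_dist d' r
    have e1 : (SimpleGraph.Walk.cons h q).IsPath :=
      SimpleGraph.Walk.isPath_of_length_eq_dist _ (by simp [hq, hd])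
    have e2 : (SimpleGraph.Walk.cons h' q').IsPath :=
      SimpleGraph.Walk.isPath_of_length_eq_dist _ (by simp [hq', hd'])
    have := (hT.existsUnique_path c r).unique e1 e2
    simpa using congrArg SimpleGraph.Walk.snd this
  have ex : ∀ c, c ≠ r → ∃ d, T.Adj c d ∧ T.dist d r + 1 = T.dist c r := by
    intro c hc
    obtain ⟨q, hq⟩ := hT.1.exists_walk_length_eq_dist c r
    cases q with
    | nil => exact absurd rfl hc
    | @cons _ d _ h q =>
      refine ⟨d, h, ?_⟩
      have h1 := SimpleGraph.dist_le q
      have h2 := hT.1.dist_triangle (u := c) (v := d) (w := r)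
      have h3 := SimpleGraph.dist_eq_one_iff_adj.2 h
      simp at hq
      omega
  choose! p hp hp' using ex
  refine ⟨p, fun c => T.dist c r, fun c hc => by have := hp' c hc; dsimp only; omega, hp, ?_⟩
  intro c d h
  have h1 := hT.dist_ne_of_adj r h
  have h3 := SimpleGraph.dist_eq_one_iff_adj.2 h
  have h4 := SimpleGraph.dist_eq_one_iff_adj.2 h.symm
  have t1 := hT.1.dist_triangle (u := c) (v := d) (w := r)
  have t2 := hT.1.dist_triangle (u := d) (v := c) (w := r)
  rw [T.dist_comm, T.dist_comm (u := r)] at h1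
  rcases lt_or_gt_of_ne h1 with hlt | hlt
  · right
    have hd : d ≠ r := by rintro rfl; simp at hlt
    exact ⟨hd, key d _ _ (hp d hd) h.symm (hp' d hd) (by omega)⟩
  · left
    have hc : c ≠ r := by rintro rfl; simp at hlt
    exact ⟨hc, key c _ _ (hp c hc) h (hp' c hc) (by omega)⟩

/-- Reachability along `R` is witnessed by a unit flow along distinct arcs of `R`. -/
theorem exists_unit_flow {N : Type*} [Fintype N] [DecidableEq N] (R : N → N → Prop) {x y : N}
    (h : Relation.ReflTransGen R x y) :
    ∃ H : N → N → ℤ, (∀ a b, H a b = 0 ∨ (H a b = 1 ∧ R a b)) ∧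
      ∀ a, ∑ b, (H a b - H b a) = (if a = x then 1 else 0) - (if a = y then 1 else 0) := by
  have walk : ∃ l : List N, (x :: l).Nodup ∧ (x :: l).IsChain R ∧
      (x :: l).getLast (by simp) = y := by
    induction h using Relation.ReflTransGen.head_induction_on with
    | refl => exact ⟨[], by simp⟩
    | @head a c hac hcb ih =>
      obtain ⟨l, h1, h2, h3⟩ := ih
      by_cases ha : a ∈ c :: l
      · obtain ⟨s, t, hst⟩ := List.append_of_mem ha
        refine ⟨t, ?_, ?_, ?_⟩
        · rw [hst] at h1; exact (List.nodup_append.1 h1).2.1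
        · rw [hst] at h2; exact (List.isChain_append.1 h2).2.1
        · rw [← h3]; simp [hst]
      · refine ⟨c :: l, ?_, ?_, ?_⟩
        · exact List.nodup_cons.2 ⟨ha, h1⟩
        · exact List.isChain_cons_cons.2 ⟨hac, h2⟩
        · simpa using h3
  clear h
  obtain ⟨l, h1, h2, h3⟩ := walk
  suffices ∃ H : N → N → ℤ, (∀ a b, H a b = 0 ∨ (H a b = 1 ∧ R a b ∧ a ∈ x :: l)) ∧
      ∀ a, ∑ b, (H a b - H b a) = (if a = x then 1 else 0) - (if a = y then 1 else 0) by
    obtain ⟨H, hH, hH'⟩ := this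
    exact ⟨H, fun a b => (hH a b).imp_right fun h => ⟨h.1, h.2.1⟩, hH'⟩
  induction l generalizing x with
  | nil =>
    simp at h3
    subst h3
    exact ⟨fun _ _ => 0, by simp, by simp⟩
  | cons c l ih =>
    obtain ⟨H, hH, hH'⟩ := ih (List.nodup_cons.1 h1).2 (List.isChain_cons_cons.1 h2).2
      (by simpa using h3)
    have hx := (List.nodup_cons.1 h1).1
    have hR := (List.isChain_cons_cons.1 h2).1
    refine ⟨fun a b => H a b + if a = x ∧ b = c then 1 else 0, fun a b => ?_, fun a => ?_⟩
    · by_cases hab : a = x ∧ b = c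
      · obtain ⟨rfl, rfl⟩ := hab
        right
        have : H a b = 0 := (hH a b).resolve_right fun h => hx h.2.2
        simp [this, hR]
      · simp only [hab, if_false, add_zero]
        exact (hH a b).imp_right fun h => ⟨h.1, h.2.1, List.mem_cons_of_mem _ h.2.2⟩
    · have e : ∀ b, (H a b + if a = x ∧ b = c then 1 else 0) -
          (H b a + if b = x ∧ a = c then 1 else 0) = (H a b - H b a) +
          ((if a = x then (if b = c then 1 else 0) else 0) -
            (if a = c then (if b = x then 1 else 0) else 0)) := by
        intro b
        simp only [ite_and]
        split_ifs <;> ring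
      simp only [e, Finset.sum_add_distrib, hH' a, Finset.sum_sub_distrib]
      split_ifs <;> simp

/-- The net outflow of a set closed under residual arcs is nonpositive. -/
theorem sum_div_le_zero {N : Type*} [Fintype N] [DecidableEq N] (z : N → N → ℤ) (R : Finset N)
    (hR : ∀ a ∈ R, ∀ b, (0 < z a b ∨ z b a < 0) → b ∈ R) :
    ∑ a ∈ R, ∑ b, (z a b - z b a) ≤ 0 := by
  have h1 : ∀ a, ∑ b, (z a b - z b a) =
      ∑ b ∈ R, (z a b - z b a) + ∑ b ∈ Rᶜ, (z a b - z b a) := fun a =>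
    (Finset.sum_add_sum_compl R _).symm
  simp only [h1, Finset.sum_add_distrib]
  have h2 : ∑ a ∈ R, ∑ b ∈ R, (z a b - z b a) = 0 := by
    simp only [Finset.sum_sub_distrib]
    rw [Finset.sum_comm, sub_self]
  rw [h2, zero_add]
  refine Finset.sum_nonpos fun a ha => Finset.sum_nonpos fun b hb => ?_
  by_contra hcon
  exact Finset.mem_compl.1 hb (hR a ha b (by by_contra h; push Not at h; omega))

/-- Hall's theorem with deficiency, producing a permutation. -/
theorem exists_perm_of_deficiency {n D : ℕ} (good : Fin n → Fin n → Prop)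
    [∀ i j, Decidable (good i j)]
    (h : ∀ P : Finset (Fin n), P.card ≤ (Finset.univ.filter fun j => ∃ i ∈ P, good i j).card + D) :
    ∃ θ : Equiv.Perm (Fin n), (Finset.univ.filter fun i => ¬ good i (θ i)).card ≤ D := by
  let t : Fin n → Finset (Fin n ⊕ Fin D) := fun i =>
    (Finset.univ.filter (good i)).disjSum Finset.univ
  obtain ⟨f, hf, hft⟩ := (Finset.all_card_le_biUnion_card_iff_exists_injective t).1 (by
    intro P
    rcases P.eq_empty_or_nonempty with rfl | hP
    · simp
    · have : P.biUnion t =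
          (Finset.univ.filter fun j => ∃ i ∈ P, good i j).disjSum Finset.univ := by
        ext x
        rcases x with x | x
        · simp [t]
        · simpa [t] using (show ∃ i, i ∈ P from hP)
      rw [this, Finset.card_disjSum]
      simpa using h P)
  let s : Finset (Fin n) := Finset.univ.filter fun i => (f i).isLeft
  let f' : Fin n → Fin n := fun i => (f i).elim id (fun _ => i)
  have hs : ∀ i ∈ s, f i = Sum.inl (f' i) := by
    intro i hi
    simp only [s, Finset.mem_filter, Finset.mem_univ, true_and] at hi
    obtain ⟨y, hy⟩ := Sum.isLeft_iff.1 hi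
    simp [f', hy]
  obtain ⟨g, hg⟩ := Finset.exists_equiv_extend_of_card_eq (α := Fin n) (t := Finset.univ)
    (by simp) (s := s) (f := f') (by simp) (by
      intro i hi j hj hij
      exact hf (by rw [hs i hi, hs j hj, hij]))
  refine ⟨g.trans (Equiv.subtypeUnivEquiv (by simp)), ?_⟩
  have hsub : (Finset.univ.filter fun i =>
      ¬ good i ((g.trans (Equiv.subtypeUnivEquiv (by simp))) i)) ⊆ sᶜ := by
    intro i hi
    rw [Finset.mem_compl]
    intro his
    have h1 := hft i
    rw [hs i his] at h1
    simp only [Finset.mem_filter, Finset.mem_univ, true_and] at hi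
    apply hi
    have h2 := hg i his
    simp only [Equiv.trans_apply, Equiv.subtypeUnivEquiv_apply]
    rw [h2]
    simpa [t] using h1
  refine (Finset.card_le_card hsub).trans ?_
  have : (sᶜ.image f) ⊆ (Finset.univ : Finset (Fin D)).map ⟨Sum.inr, Sum.inr_injective⟩ := by
    intro x hx
    obtain ⟨i, hi, rfl⟩ := Finset.mem_image.1 hx
    simp only [s, Finset.mem_compl, Finset.mem_filter, Finset.mem_univ, true_and] at hi
    obtain ⟨y, hy⟩ := Sum.isRight_iff.1 (by simpa using hi)
    simp [hy]
  have := Finset.card_le_card this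
  rwa [Finset.card_image_of_injective _ hf, Finset.card_map, Finset.card_univ,
    Fintype.card_fin] at this

/-- A map from `Fin n` whose fibers over a nonempty finite set all have the same size. -/
theorem exists_balanced_map {V : Type*} [Fintype V] [DecidableEq V] (A : Finset V) (n s : ℕ)
    (hn : n = A.card * s) :
    ∃ π : Fin n → V, (∀ i, π i ∈ A) ∧
      ∀ v ∈ A, (Finset.univ.filter fun i => π i = v).card = s := by
  have e : Fin n ≃ A × Fin s := Fintype.equivOfCardEq (by simp [hn])
  refine ⟨fun i => (e i).1, fun i => (e i).1.2, fun v hv => ?_⟩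
  have : (Finset.univ.filter fun i => ((e i).1 : V) = v) =
      (Finset.univ : Finset (Fin s)).image fun t => e.symm (⟨v, hv⟩, t) := by
    ext i
    simp only [Finset.mem_filter, Finset.mem_univ, true_and, Finset.mem_image]
    constructor
    · intro h
      exact ⟨(e i).2, by rw [Equiv.symm_apply_eq]; ext <;> simp [h]⟩
    · rintro ⟨t, rfl⟩
      simp
  rw [this, Finset.card_image_of_injective]
  · simp
  · intro a b h
    simpa using h

theorem exists_ncard_adj_le_one {C : Type*} [Finite C] (T : SimpleGraph C) (hT : T.IsTree) :
    ∃ r, {x | T.Adj r x}.ncard ≤ 1 := by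
  classical
  have _ := Fintype.ofFinite C
  have _ := hT.1.nonempty
  rcases subsingleton_or_nontrivial C with h | h
  · obtain ⟨r⟩ := hT.1.nonempty
    exact ⟨r, Set.ncard_le_one_iff_subsingleton.2 Set.subsingleton_of_subsingleton⟩
  · obtain ⟨r, hr⟩ := hT.exists_vert_degree_one_of_nontrivial
    refine ⟨r, le_of_eq ?_⟩
    rw [← hr, ← SimpleGraph.card_neighborFinset_eq_degree, ← Set.ncard_coe_finset]
    congr 1
    ext x
    simp

/-- In a tree rooted at a leaf, a vertex of degree two has exactly one child. -/
theorem exists_unique_child {C : Type*} (T : SimpleGraph C) (r : C) (p : C → C) (depth : C → ℕ)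
    (hdepth : ∀ c, c ≠ r → depth (p c) < depth c) (hadj : ∀ c, c ≠ r → T.Adj c (p c))
    (hpar : ∀ c d, T.Adj c d → (c ≠ r ∧ p c = d) ∨ (d ≠ r ∧ p d = c))
    (hr : {x | T.Adj r x}.ncard ≤ 1) (c : C) (hc : {x | T.Adj c x}.ncard = 2) :
    ∃ d, d ≠ r ∧ p d = c ∧ ∀ d', d' ≠ r → p d' = c → d' = d := by
  have hcr : c ≠ r := by rintro rfl; omega
  have hmem : ∀ d, d ≠ r → p d = c → T.Adj c d ∧ d ≠ p c := by
    rintro d hd rfl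
    refine ⟨(hadj d hd).symm, fun h => ?_⟩
    have h1 := hdepth d hd
    have h2 := hdepth _ hcr
    rw [← h] at h2
    omega
  have huniq : ∃ d, T.Adj c d ∧ d ≠ p c ∧ ∀ d', T.Adj c d' → d' ≠ p c → d' = d := by
    obtain ⟨a, b, hab, hs⟩ := Set.ncard_eq_two.1 hc
    have hs' : ∀ x, T.Adj c x ↔ x = a ∨ x = b := fun x => by
      simpa using Set.ext_iff.1 hs x
    rcases (hs' _).1 (hadj c hcr) with h | h
    · exact ⟨b, (hs' b).2 (Or.inr rfl), fun h' => hab (h.symm.trans h'.symm),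
        fun d' h1 h2 => ((hs' d').1 h1).resolve_left fun h3 => h2 (h3.trans h.symm)⟩
    · exact ⟨a, (hs' a).2 (Or.inl rfl), fun h' => hab (h'.trans h),
        fun d' h1 h2 => ((hs' d').1 h1).resolve_right fun h3 => h2 (h3.trans h.symm)⟩
  obtain ⟨d, h1, h2, h3⟩ := huniq
  rcases hpar c d h1 with ⟨-, h⟩ | ⟨h, h'⟩
  · exact absurd h.symm h2
  · exact ⟨d, h, h', fun d' hd' hp => h3 d' (hmem d' hd' hp).1 (hmem d' hd' hp).2⟩

/-- A rooted tree on `C` with a set `S` of special vertices such that every non-special vertex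
has exactly one child `ch c`. The non-special vertices subdivide segments between special ones:
for a non-root vertex `c`, `hd c` is the highest and `lab c` the lowest non-root vertex on the
segment of the edge from `c` to its parent `p c`. -/
structure Skeleton {C : Type*} (r : C) (S : C → Prop) (p ch hd lab : C → C) (depth : C → ℕ) :
    Prop where
  S_root : S r
  depth_p : ∀ c, c ≠ r → depth (p c) < depth c
  ch_ne : ∀ c, ¬ S c → ch c ≠ r
  p_ch : ∀ c, ¬ S c → p (ch c) = c
  ch_unique : ∀ c d, ¬ S c → d ≠ r → p d = c → d = ch c
  hd_top : ∀ c, c ≠ r → S (p c) → hd c = c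
  hd_step : ∀ c, c ≠ r → ¬ S (p c) → hd c = hd (p c)
  hd_ne : ∀ c, c ≠ r → hd c ≠ r
  S_p_hd : ∀ c, c ≠ r → S (p (hd c))
  depth_hd : ∀ c, c ≠ r → depth (hd c) ≤ depth c
  lab_self : ∀ c, S c → lab c = c
  lab_step : ∀ c, ¬ S c → lab c = lab (ch c)
  S_lab : ∀ c, S (lab c)
  lab_ne : ∀ c, c ≠ r → lab c ≠ r
  hd_lab : ∀ c, c ≠ r → hd (lab c) = hd c

theorem exists_skeleton {C : Type*} [Finite C] (r : C) (S : C → Prop) (p : C → C)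
    (depth : C → ℕ) (hr : S r) (hdepth : ∀ c, c ≠ r → depth (p c) < depth c)
    (hch : ∀ c, ¬ S c → ∃ d, d ≠ r ∧ p d = c ∧ ∀ d', d' ≠ r → p d' = c → d' = d) :
    ∃ ch hd lab : C → C, Skeleton r S p ch hd lab depth := by
  classical
  have _ := Fintype.ofFinite C
  choose! ch hch1 hch2 hch3 using hch
  have ne_root : ∀ c, ¬ S c → c ≠ r := fun c hc h => hc (h ▸ hr)
  have hmax : ∀ c, depth c ≤ ∑ d, depth d := fun c =>
    Finset.single_le_sum (f := depth) (fun _ _ => Nat.zero_le _) (Finset.mem_univ c)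
  obtain ⟨hd, hd1, hd2⟩ := exists_recursive depth (fun c => c = r ∨ S (p c)) p
    (fun c hc => hdepth c fun h => hc (Or.inl h)) id (fun _ => id)
  have hup : ∀ c, ¬ S c → (∑ d, depth d) - depth (ch c) < (∑ d, depth d) - depth c := by
    intro c hc
    have h1 := hdepth (ch c) (hch1 c hc)
    rw [hch2 c hc] at h1
    have := hmax (ch c)
    omega
  obtain ⟨lab, lab1, lab2⟩ := exists_recursive (fun c => (∑ d, depth d) - depth c) S ch hup id
    (fun _ => id)
  have hd_top : ∀ c, c ≠ r → S (p c) → hd c = c := fun c _ h => hd1 c (Or.inr h)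
  have hd_step : ∀ c, c ≠ r → ¬ S (p c) → hd c = hd (p c) := fun c hc h =>
    hd2 c (by tauto)
  have hdall : ∀ n c, depth c = n → c ≠ r →
      hd c ≠ r ∧ S (p (hd c)) ∧ depth (hd c) ≤ depth c := by
    intro n
    induction n using Nat.strong_induction_on with
    | _ n ih =>
      intro c hn hc
      by_cases hS : S (p c)
      · rw [hd_top c hc hS]; exact ⟨hc, hS, le_rfl⟩
      · have h1 := hdepth c hc
        obtain ⟨a, b, d⟩ := ih _ (hn ▸ h1) (p c) rfl (ne_root _ hS)
        rw [hd_step c hc hS]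
        exact ⟨a, b, by omega⟩
  have laball : ∀ n c, (∑ d, depth d) - depth c = n →
      S (lab c) ∧ (c ≠ r → lab c ≠ r ∧ hd (lab c) = hd c) := by
    intro n
    induction n using Nat.strong_induction_on with
    | _ n ih =>
      intro c hn
      by_cases hS : S c
      · have : lab c = c := lab1 c hS
        rw [this]; exact ⟨hS, fun h => ⟨h, rfl⟩⟩
      · have h1 := hup c hS
        obtain ⟨a, b⟩ := ih _ (hn ▸ h1) (ch c) rfl
        have e : lab c = lab (ch c) := lab2 c hS
        rw [e]
        refine ⟨a, fun h => ⟨(b (hch1 c hS)).1, ?_⟩⟩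
        rw [(b (hch1 c hS)).2, hd_step _ (hch1 c hS) (by rwa [hch2 c hS]), hch2 c hS]
  exact ⟨ch, hd, lab,
    { S_root := hr
      depth_p := hdepth
      ch_ne := hch1
      p_ch := hch2
      ch_unique := fun c d hc => hch3 c hc d
      hd_top := hd_top
      hd_step := hd_step
      hd_ne := fun c hc => (hdall _ c rfl hc).1
      S_p_hd := fun c hc => (hdall _ c rfl hc).2.1
      depth_hd := fun c hc => (hdall _ c rfl hc).2.2
      lab_self := lab1
      lab_step := lab2
      S_lab := fun c => (laball _ c rfl).1
      lab_ne := fun c hc => ((laball _ c rfl).2 hc).1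
      hd_lab := fun c hc => ((laball _ c rfl).2 hc).2 }⟩

namespace Skeleton

variable {C : Type*} {r : C} {S : C → Prop} {p ch hd lab : C → C} {depth : C → ℕ}

theorem p_ne (sk : Skeleton r S p ch hd lab depth) {c : C} (hc : c ≠ r) : p c ≠ c := fun h => by
  have := sk.depth_p c hc
  rw [h] at this
  exact lt_irrefl _ this

theorem ne_root (sk : Skeleton r S p ch hd lab depth) {c : C} (hc : ¬ S c) : c ≠ r :=
  fun h => hc (h ▸ sk.S_root)

theorem ch_ne_self (sk : Skeleton r S p ch hd lab depth) {c : C} (hc : ¬ S c) : ch c ≠ c :=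
  fun h => sk.p_ne (sk.ch_ne c hc) (by rw [sk.p_ch c hc, h])

theorem depth_up (sk : Skeleton r S p ch hd lab depth) {c : C} (hc : c ≠ r) :
    depth (p (hd c)) < depth c :=
  (sk.depth_p _ (sk.hd_ne c hc)).trans_le (sk.depth_hd c hc)

end Skeleton

section Flow

variable {V C : Type*} {χ : V → C} {r : C} {S : C → Prop} {p ch hd lab : C → C}
  {depth : C → ℕ} {F μ : V → V → ℤ} {U ν : V → ℤ}

/-- In the segment network a node `(e, v)` is an end `v` of an edge of `G` over the tree edge
from `e` to `p e`. An edge link joins the two ends of such an edge. -/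
def EdgeLink (χ : V → C) (r : C) (p : C → C) (a b : C × V) : Prop :=
  a.1 ≠ r ∧ b.1 = a.1 ∧ χ a.2 = a.1 ∧ χ b.2 = p a.1

/-- A vertex link passes through a vertex of non-special color. -/
def VertexLink (χ : V → C) (r : C) (S : C → Prop) (p : C → C) (a b : C × V) : Prop :=
  a.1 ≠ r ∧ χ a.2 = p a.1 ∧ ¬ S (p a.1) ∧ b = (p a.1, a.2)

open Classical in
/-- The function on pairs of nodes of the segment network induced by edge and vertex weights. -/
noncomputable def arcWeight (χ : V → C) (r : C) (S : C → Prop) (p : C → C) (F : V → V → ℤ)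
    (U : V → ℤ) (a b : C × V) : ℤ :=
  (if EdgeLink χ r p a b then F a.2 b.2 else 0) + if VertexLink χ r S p a b then U a.2 else 0

/-- Two nodes of the segment network joined by a link in one of the two directions. -/
def Linked (χ : V → C) (r : C) (S : C → Prop) (p : C → C) (a b : C × V) : Prop :=
  (EdgeLink χ r p a b ∨ VertexLink χ r S p a b) ∨ EdgeLink χ r p b a ∨ VertexLink χ r S p b a

theorem linked_of_arcWeight_ne {a b : C × V} (h : arcWeight χ r S p F U a b ≠ 0) :
    EdgeLink χ r p a b ∨ VertexLink χ r S p a b := by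
  by_contra hcon
  push Not at hcon
  simp [arcWeight, hcon.1, hcon.2] at h

theorem arcWeight_edge (sk : Skeleton r S p ch hd lab depth) {v v' : V} {e : C} (he : e ≠ r)
    (hv : χ v = e) (hv' : χ v' = p e) : arcWeight χ r S p F U (e, v) (e, v') = F v v' := by
  have := (sk.p_ne he).symm
  simp [arcWeight, EdgeLink, VertexLink, he, hv, hv', this]

theorem arcWeight_edge_rev (sk : Skeleton r S p ch hd lab depth) {v v' : V} {e : C} (he : e ≠ r)
    (hv' : χ v' = p e) :
    arcWeight χ r S p F U (e, v') (e, v) = 0 := by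
  have := sk.p_ne he
  simp [arcWeight, EdgeLink, VertexLink, hv', this, this.symm]

theorem arcWeight_vertex (sk : Skeleton r S p ch hd lab depth) {v : V} {e : C} (he : e ≠ r)
    (hv : p e = χ v) (hS : ¬ S (χ v)) : arcWeight χ r S p F U (e, v) (χ v, v) = U v := by
  have := sk.p_ne he
  rw [hv] at this
  simp [arcWeight, EdgeLink, VertexLink, he, hv, hS, this]

theorem arcWeight_vertex_rev (sk : Skeleton r S p ch hd lab depth) {v : V} {e : C} (he : e ≠ r)
    (hv : p e = χ v) (hS : ¬ S (χ v)) : arcWeight χ r S p F U (χ v, v) (e, v) = 0 := by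
  have h1 := sk.p_ne he
  rw [hv] at h1
  have h2 := (sk.p_ne (sk.ne_root hS)).symm
  simp [arcWeight, EdgeLink, VertexLink, h1.symm, h2]

theorem linked_of_div_ne {a b : C × V}
    (h : arcWeight χ r S p F U a b - arcWeight χ r S p F U b a ≠ 0) : Linked χ r S p a b := by
  by_cases h1 : arcWeight χ r S p F U a b = 0
  · exact Or.inr (linked_of_arcWeight_ne fun h2 => h (by rw [h1, h2, sub_zero]))
  · exact Or.inl (linked_of_arcWeight_ne h1)

theorem Linked.labels (sk : Skeleton r S p ch hd lab depth) {a b : C × V}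
    (h : Linked χ r S p a b) : b.1 ≠ r ∧ lab b.1 = lab a.1 ∧ hd b.1 = hd a.1 := by
  rcases h with (h | h) | (h | h)
  · obtain ⟨h1, h2, -, -⟩ := h
    rw [h2]; exact ⟨h1, rfl, rfl⟩
  · obtain ⟨h1, h2, h3, h4⟩ := h
    rw [h4]
    refine ⟨sk.ne_root h3, ?_, (sk.hd_step _ h1 h3).symm⟩
    rw [sk.lab_step _ h3, ← sk.ch_unique _ _ h3 h1 rfl]
  · obtain ⟨h1, h2, -, -⟩ := h
    rw [h2]; exact ⟨h1, rfl, rfl⟩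
  · obtain ⟨h1, h2, h3, h4⟩ := h
    rw [h4]
    refine ⟨h1, ?_, sk.hd_step _ h1 h3⟩
    rw [sk.lab_step _ h3, ← sk.ch_unique _ _ h3 h1 rfl]

theorem Linked.color {a b : C × V} (h : Linked χ r S p a b) :
    χ a.2 = a.1 ∨ χ a.2 = p a.1 := by
  rcases h with (h | h) | (h | h)
  · exact Or.inl h.2.2.1
  · exact Or.inr h.2.1
  · rw [h.2.1]; exact Or.inr h.2.2.2
  · have h1 := h.2.1
    rw [h.2.2.2]
    exact Or.inl h1

/-- Residual arcs of the segment network for the difference of a fractional packing and `K`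
times a packing. -/
def Residual (χ : V → C) (r : C) (S : C → Prop) (p : C → C) (K : ℕ) (F μ : V → V → ℤ)
    (U ν : V → ℤ) (a b : C × V) : Prop :=
  0 < arcWeight χ r S p (fun v v' => μ v v' - K * F v v') (fun v => ν v - K * U v) a b ∨
    arcWeight χ r S p (fun v v' => μ v v' - K * F v v') (fun v => ν v - K * U v) b a < 0

theorem Residual.linked {K : ℕ} {a b : C × V}
    (h : Residual χ r S p K F μ U ν a b) : Linked χ r S p a b := by
  rcases h with h | h
  · exact Or.inl (linked_of_arcWeight_ne h.ne')
  · exact Or.inr (linked_of_arcWeight_ne h.ne)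

theorem labels_of_reflTransGen (sk : Skeleton r S p ch hd lab depth) {K : ℕ}
    {a b : C × V}
    (h : Relation.ReflTransGen (Residual χ r S p K F μ U ν) a b) (ha : a.1 ≠ r) :
    b.1 ≠ r ∧ lab b.1 = lab a.1 ∧ hd b.1 = hd a.1 := by
  induction h with
  | refl => exact ⟨ha, rfl, rfl⟩
  | tail _ h ih =>
    obtain ⟨h1, h2, h3⟩ := h.linked.labels sk
    exact ⟨h1, h2.trans ih.2.1, h3.trans ih.2.2⟩

theorem residual_edge (sk : Skeleton r S p ch hd lab depth) {K : ℕ} {v v' : V} (hv : χ v ≠ r)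
    (hv' : χ v' = p (χ v)) (h : Residual χ r S p K F μ U ν (χ v, v) (χ v, v')) :
    K * F v v' < μ v v' := by
  simpa [Residual, arcWeight_edge sk hv rfl hv', arcWeight_edge_rev sk hv hv'] using h

theorem residual_edge_rev (sk : Skeleton r S p ch hd lab depth) {K : ℕ} {v v' : V}
    (hv : χ v ≠ r) (hv' : χ v' = p (χ v))
    (h : Residual χ r S p K F μ U ν (χ v, v') (χ v, v)) : μ v v' < K * F v v' := by
  simpa [Residual, arcWeight_edge sk hv rfl hv', arcWeight_edge_rev sk hv hv'] using h

theorem residual_vertex (sk : Skeleton r S p ch hd lab depth) {K : ℕ} {v : V} (hS : ¬ S (χ v))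
    (h : Residual χ r S p K F μ U ν (ch (χ v), v) (χ v, v)) : K * U v < ν v := by
  simpa [Residual, arcWeight_vertex sk (sk.ch_ne _ hS) (sk.p_ch _ hS) hS,
    arcWeight_vertex_rev sk (sk.ch_ne _ hS) (sk.p_ch _ hS) hS] using h

theorem residual_vertex_rev (sk : Skeleton r S p ch hd lab depth) {K : ℕ} {v : V}
    (hS : ¬ S (χ v)) (h : Residual χ r S p K F μ U ν (χ v, v) (ch (χ v), v)) :
    ν v < K * U v := by
  simpa [Residual, arcWeight_vertex sk (sk.ch_ne _ hS) (sk.p_ch _ hS) hS,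
    arcWeight_vertex_rev sk (sk.ch_ne _ hS) (sk.p_ch _ hS) hS] using h

variable [Fintype V] [DecidableEq C]

/-- Edge weights `F` and vertex weights `U` such that every vertex has weight equal to the
weight of the edges joining it to each class adjacent to its own in the rooted tree. -/
structure IsBalanced (χ : V → C) (r : C) (p : C → C) (F : V → V → ℤ) (U : V → ℤ) : Prop where
  up : ∀ v, χ v ≠ r → ∑ v' with χ v' = p (χ v), F v v' = U v
  down : ∀ v' d, d ≠ r → p d = χ v' → ∑ v with χ v = d, F v v' = U v'

theorem IsBalanced.sub_mul (h1 : IsBalanced χ r p μ ν)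
    (h2 : IsBalanced χ r p F U) (K : ℤ) :
    IsBalanced χ r p (fun v v' => μ v v' - K * F v v') (fun v => ν v - K * U v) where
  up v hv := by rw [Finset.sum_sub_distrib, ← Finset.mul_sum, h1.up v hv, h2.up v hv]
  down v d hd hv := by
    rw [Finset.sum_sub_distrib, ← Finset.mul_sum, h1.down v d hd hv, h2.down v d hd hv]

theorem IsBalanced.sum_class (sk : Skeleton r S p ch hd lab depth)
    (hF : IsBalanced χ r p F U) (c : C) : ∑ v with χ v = c, U v = ∑ v with χ v = r, U v := by
  induction hn : depth c using Nat.strong_induction_on generalizing c with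
  | _ n ih =>
    by_cases hc : c = r
    · rw [hc]
    · rw [← ih _ (hn ▸ sk.depth_p c hc) (p c) rfl]
      calc ∑ v with χ v = c, U v = ∑ v with χ v = c, ∑ v' with χ v' = p c, F v v' := by
            refine Finset.sum_congr rfl fun v hv => ?_
            rw [Finset.mem_filter] at hv
            rw [← hF.up v (hv.2 ▸ hc), hv.2]
        _ = ∑ v' with χ v' = p c, ∑ v with χ v = c, F v v' := Finset.sum_comm
        _ = _ := by
            refine Finset.sum_congr rfl fun v hv => ?_
            rw [Finset.mem_filter] at hv
            exact hF.down v c hc hv.2.symm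

/-- The indicator functions of the edges and vertices of `k` disjoint copies of the tree. -/
structure IsPacking (G : SimpleGraph V) (χ : V → C) (r : C) (p : C → C) (k : ℕ)
    (F : V → V → ℤ) (U : V → ℤ) : Prop where
  balanced : IsBalanced χ r p F U
  F_nonneg : ∀ v v', 0 ≤ F v v'
  F_adj : ∀ v v', F v v' ≠ 0 → G.Adj v v'
  U_nonneg : ∀ v, 0 ≤ U v
  U_le_one : ∀ v, U v ≤ 1
  count : ∑ v with χ v = r, U v = k

theorem IsPacking.empty (G : SimpleGraph V) : IsPacking G χ r p 0 (fun _ _ => 0) fun _ => 0 where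
  balanced := ⟨by simp, by simp⟩
  F_nonneg := by simp
  F_adj := by simp
  U_nonneg := by simp
  U_le_one := by simp
  count := by simp

/-- A fractional packing, scaled so that every vertex has capacity `K`. -/
structure IsFractional (G : SimpleGraph V) (χ : V → C) (r : C) (p : C → C) (K : ℕ)
    (μ : V → V → ℤ) (ν : V → ℤ) : Prop where
  balanced : IsBalanced χ r p μ ν
  μ_nonneg : ∀ v v', 0 ≤ μ v v'
  μ_adj : ∀ v v', μ v v' ≠ 0 → G.Adj v v'
  ν_nonneg : ∀ v, 0 ≤ ν v
  ν_le : ∀ v, ν v ≤ K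

/-- A packing of size `k` decomposes into `k` copies of the tree. -/
theorem IsPacking.exists_copies {G : SimpleGraph V} (sk : Skeleton r S p ch hd lab depth)
    {k : ℕ} (hF : IsPacking G χ r p k F U) :
    ∃ f : Fin k → C → V, (∀ j c, χ (f j c) = c) ∧
      (∀ j c, c ≠ r → G.Adj (f j c) (f j (p c))) ∧ ∀ c j j', f j c = f j' c → j = j' := by
  classical
  have hcases : ∀ v, U v = 0 ∨ U v = 1 := fun v => by
    have := hF.U_nonneg v
    have := hF.U_le_one v
    omega
  have hcard : (Finset.univ.filter fun v => χ v = r ∧ U v = 1).card = k := by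
    have h := hF.count
    have : ∀ v ∈ Finset.univ.filter (fun v => χ v = r), U v = if U v = 1 then 1 else 0 := by
      intro v _
      rcases hcases v with h | h <;> simp [h]
    rw [Finset.sum_congr rfl this, Finset.sum_boole, Finset.filter_filter] at h
    exact_mod_cast h
  let e := Finset.equivFinOfCardEq hcard
  have he : ∀ j, χ (e.symm j) = r ∧ U (e.symm j) = 1 := fun j =>
    (Finset.mem_filter.1 (e.symm j).2).2
  have hdesc : ∀ d v', d ≠ r ∧ p d = χ v' ∧ U v' = 1 → ∃ v, χ v = d ∧ F v v' ≠ 0 := by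
    rintro d v' ⟨h1, h2, h3⟩
    have h := hF.balanced.down v' d h1 h2
    obtain ⟨v, hv, hne⟩ := Finset.exists_ne_zero_of_sum_ne_zero (h.trans_ne (by omega))
    exact ⟨v, (Finset.mem_filter.1 hv).2, hne⟩
  have _ : ∀ _ : V, Nonempty V := fun v => ⟨v⟩
  choose! g hg using hdesc
  obtain ⟨f, hf1, hf2⟩ := exists_recursive depth (· = r) p sk.depth_p
    (fun _ (j : Fin k) => (e.symm j : V)) (fun c t j => g c (t j))
  have hstep : ∀ c, c ≠ r → (∀ j, χ (f (p c) j) = p c ∧ U (f (p c) j) = 1) →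
      ∀ j, χ (f c j) = c ∧ F (f c j) (f (p c) j) ≠ 0 := by
    intro c hc h j
    rw [hf2 c hc]
    exact hg c _ ⟨hc, (h j).1.symm, (h j).2⟩
  have hmain : ∀ n c, depth c = n → (∀ j, χ (f c j) = c ∧ U (f c j) = 1) ∧
      Function.Injective (f c) := by
    intro n
    induction n using Nat.strong_induction_on with
    | _ n ih =>
      intro c hn
      by_cases hc : c = r
      · rw [hf1 c hc]
        refine ⟨fun j => ⟨(he j).1.trans hc.symm, (he j).2⟩, fun j j' h => ?_⟩
        simpa using Subtype.ext h
      · obtain ⟨h1, h2⟩ := ih _ (hn ▸ sk.depth_p c hc) (p c) rfl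
        have h3 := hstep c hc h1
        have hup : ∀ j, ∑ v' with χ v' = p c, F (f c j) v' = U (f c j) := by
          intro j
          have := hF.balanced.up (f c j) (by rw [(h3 j).1]; exact hc)
          rwa [(h3 j).1] at this
        refine ⟨fun j => ⟨(h3 j).1, ?_⟩, fun j j' h => ?_⟩
        · refine (hcases _).resolve_left fun h0 => (h3 j).2 ?_
          have := hup j
          rw [h0, Finset.sum_eq_zero_iff_of_nonneg fun _ _ => hF.F_nonneg _ _] at this
          exact this _ (by simp [(h1 j).1])
        · by_contra hne
          have hne' : f (p c) j ≠ f (p c) j' := fun h => hne (h2 h)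
          have hle : ∑ v' ∈ {f (p c) j, f (p c) j'}, F (f c j) v' ≤ U (f c j) := by
            rw [← hup j]
            refine Finset.sum_le_sum_of_subset_of_nonneg ?_ fun _ _ _ => hF.F_nonneg _ _
            intro v hv
            simp only [Finset.mem_insert, Finset.mem_singleton] at hv
            rcases hv with rfl | rfl <;> simp [(h1 _).1]
          rw [Finset.sum_pair hne'] at hle
          have h4 := (h3 j).2
          have h5 := (h3 j').2
          rw [← h] at h5
          have h6 := hF.F_nonneg (f c j) (f (p c) j)
          have h7 := hF.F_nonneg (f c j) (f (p c) j')
          have h8 := hF.U_le_one (f c j)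
          omega
  refine ⟨fun j c => f c j, fun j c => ((hmain _ c rfl).1 j).1, fun j c hc => ?_,
    fun c j j' h => (hmain _ c rfl).2 h⟩
  exact hF.F_adj _ _ (hstep c hc (hmain _ (p c) rfl).1 j).2

/-- The uniform fractional packing of a stable coloring. -/
theorem exists_fractional [Fintype C] (G : SimpleGraph V) (χ : V → C) [DecidableRel G.Adj]
    (hst : ∀ v w, χ v = χ w → ∀ c, (Finset.univ.filter fun u => G.Adj v u ∧ χ u = c).card =
      (Finset.univ.filter fun u => G.Adj w u ∧ χ u = c).card) (r : C) (p : C → C)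
    (hedge : ∀ c, c ≠ r → ∃ v v', χ v = c ∧ χ v' = p c ∧ G.Adj v v') (m : ℕ) (hm : 0 < m)
    (c₀ : C) (hc₀ : (Finset.univ.filter fun v => χ v = c₀).card = m)
    (hmin : ∀ c, m ≤ (Finset.univ.filter fun v => χ v = c).card) :
    ∃ (n K : ℕ) (μ : V → V → ℤ) (ν : V → ℤ) (s : C → ℕ), IsFractional G χ r p K μ ν ∧
      (∀ v, ν v = s (χ v)) ∧ (∀ c, n = (Finset.univ.filter fun v => χ v = c).card * s c) ∧
      0 < n ∧ K * m = n := by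
  set cls : C → ℕ := fun c => (Finset.univ.filter fun v => χ v = c).card with hcls
  set deg : V → C → ℕ := fun v c => (Finset.univ.filter fun u => G.Adj v u ∧ χ u = c).card
    with hdeg
  let E : C → ℕ := fun c => if c = r then 1 else ∑ v with χ v = c, deg v (p c)
  have hE1 : ∀ v, χ v ≠ r → E (χ v) = cls (χ v) * deg v (p (χ v)) := by
    intro v hv
    simp only [E, hv, if_false]
    rw [Finset.sum_congr rfl fun w hw => hst w v (Finset.mem_filter.1 hw).2 (p (χ v)),
      Finset.sum_const, smul_eq_mul]
  have hE2 : ∀ v d, d ≠ r → p d = χ v → E d = cls (χ v) * deg v d := by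
    intro v d hd hp
    simp only [E, hd, if_false]
    have h := Finset.sum_card_bipartiteAbove_eq_sum_card_bipartiteBelow G.Adj
      (s := Finset.univ.filter fun v => χ v = d) (t := Finset.univ.filter fun w => χ w = χ v)
    have h1 : ∀ w, deg w (p d) =
        (Finset.bipartiteAbove G.Adj (Finset.univ.filter fun w => χ w = χ v) w).card := by
      intro w
      simp only [hdeg, Finset.bipartiteAbove, Finset.filter_filter, hp]
      congr 1; ext u; simp [and_comm]
    have h2 : ∀ w ∈ Finset.univ.filter (fun w => χ w = χ v),
        (Finset.bipartiteBelow G.Adj (Finset.univ.filter fun v => χ v = d) w).card =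
          deg v d := by
      intro w hw
      have h3 : deg v d = deg w d := hst v w (Finset.mem_filter.1 hw).2.symm d
      rw [h3]
      simp only [hdeg, Finset.bipartiteBelow, Finset.filter_filter]
      congr 1; ext u; simp [and_comm, G.adj_comm]
    rw [Finset.sum_congr rfl fun w _ => h1 w, h, Finset.sum_congr rfl h2, Finset.sum_const,
      smul_eq_mul]
  have hclspos : ∀ c, 0 < cls c := fun c => hm.trans_le (hmin c)
  have hEpos : ∀ c, 0 < E c := by
    intro c
    by_cases hc : c = r
    · simp [E, hc]
    · obtain ⟨v, v', rfl, hv', hadj⟩ := hedge c hc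
      rw [hE1 v hc]
      exact Nat.mul_pos (hclspos _) (Finset.card_pos.2 ⟨v', by simp [hadj, hv']⟩)
  let n := (∏ c, cls c) * ∏ c, E c
  have hclsdvd : ∀ c, cls c ∣ n := fun c =>
    (Finset.dvd_prod_of_mem _ (Finset.mem_univ c)).mul_right _
  have hEdvd : ∀ c, E c ∣ n := fun c =>
    (Finset.dvd_prod_of_mem _ (Finset.mem_univ c)).mul_left _
  have hdiv : ∀ c d, c ≠ r → ∀ t, E c = cls d * t → t * (n / E c) = n / cls d := by
    intro c d _ t ht
    obtain ⟨q, hq⟩ := hEdvd c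
    rw [hq, Nat.mul_div_cancel_left _ (hEpos c), ht, mul_assoc,
      Nat.mul_div_cancel_left _ (hclspos d)]
  refine ⟨n, n / m, fun v v' => if G.Adj v v' then ((n / E (χ v) : ℕ) : ℤ) else 0,
    fun v => ((n / cls (χ v) : ℕ) : ℤ), fun c => n / cls c, ⟨⟨?_, ?_⟩, ?_, ?_, ?_, ?_⟩,
    fun _ => rfl, fun c => (Nat.mul_div_cancel' (hclsdvd c)).symm, ?_, ?_⟩
  · intro v hv
    rw [← hdiv _ _ hv _ (hE1 v hv), ← Finset.sum_filter, Finset.sum_const, Finset.filter_filter,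
      nsmul_eq_mul, Nat.cast_mul]
    simp only [hdeg, and_comm]
  · intro v d hd hp
    rw [← hdiv _ _ hd _ (hE2 v d hd hp), ← Finset.sum_filter, Finset.filter_filter]
    rw [Finset.sum_congr rfl (g := fun _ => ((n / E d : ℕ) : ℤ)) (by
      intro w hw
      rw [(Finset.mem_filter.1 hw).2.1]), Finset.sum_const, nsmul_eq_mul, Nat.cast_mul]
    simp only [hdeg, and_comm, G.adj_comm]
  · intro v v'
    split_ifs <;> positivity
  · intro v v' h
    by_contra hcon
    simp [hcon] at h
  · intro v
    positivity
  · intro v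
    exact_mod_cast Nat.div_le_div_left (hmin (χ v)) hm
  · exact Nat.mul_pos (Finset.prod_pos fun c _ => hclspos c) (Finset.prod_pos fun c _ => hEpos c)
  · exact Nat.div_mul_cancel (hc₀ ▸ hclsdvd c₀)

variable [Fintype C] [DecidableEq V]

open Classical in
theorem sum_bottom (sk : Skeleton r S p ch hd lab depth) {D : C × V → C × V → ℤ}
    (hD : ∀ a b, D a b ≠ 0 → Linked χ r S p a b) (v : V) (hv : χ v ≠ r) :
    ∑ b, D (χ v, v) b = ∑ v' with χ v' = p (χ v), D (χ v, v) (χ v, v') +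
      if S (χ v) then 0 else D (χ v, v) (ch (χ v), v) := by
  have hp := sk.p_ne hv
  have key : ∀ b : C × V, D (χ v, v) b =
      (if b.1 = χ v then if χ b.2 = p (χ v) then D (χ v, v) (χ v, b.2) else 0 else 0) +
      if b.1 = ch (χ v) then if b.2 = v then
        (if S (χ v) then 0 else D (χ v, v) (ch (χ v), v)) else 0 else 0 := by
    rintro ⟨e, w⟩
    by_cases h0 : D (χ v, v) (e, w) = 0
    · rw [h0]
      have h1 : e = χ v → D (χ v, v) (χ v, w) = 0 := by rintro rfl; exact h0
      have h2 : e = ch (χ v) → w = v → D (χ v, v) (ch (χ v), v) = 0 := by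
        rintro rfl rfl; exact h0
      dsimp only
      grind
    · rcases hD _ _ h0 with (h | h) | (h | h)
      · obtain ⟨-, h1, -, h2⟩ := h
        dsimp only at h1 h2
        subst h1
        by_cases hS : S (χ v)
        · simp [h2, hS]
        · simp [h2, (sk.ch_ne_self hS).symm]
      · exact absurd h.2.1.symm hp
      · obtain ⟨-, h1, -, h2⟩ := h
        dsimp only at h1 h2
        exact absurd (by rw [h1, ← h2]; exact h1) hp
      · obtain ⟨h1, h2, h3, h4⟩ := h
        simp only [Prod.mk.injEq] at h4
        obtain ⟨h4, rfl⟩ := h4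
        dsimp only at h1 h2 h3
        have hS : ¬ S (χ v) := by rwa [h4]
        have he : e = ch (χ v) := sk.ch_unique _ _ hS h1 h4.symm
        subst he
        simp [hS, sk.ch_ne_self hS]
  rw [Finset.sum_congr rfl fun b _ => key b, Finset.sum_add_distrib, Fintype.sum_prod_type, Fintype.sum_prod_type]
  congr 1
  · rw [Finset.sum_comm]
    simp [Finset.sum_filter]
  · rw [Finset.sum_comm]
    simp

open Classical in
theorem sum_top (sk : Skeleton r S p ch hd lab depth) {D : C × V → C × V → ℤ}
    (hD : ∀ a b, D a b ≠ 0 → Linked χ r S p a b) (v : V) (e : C) (he : e ≠ r) (hv : p e = χ v) :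
    ∑ b, D (e, v) b = ∑ v' with χ v' = e, D (e, v) (e, v') +
      if S (χ v) then 0 else D (e, v) (χ v, v) := by
  have hp := sk.p_ne he
  have key : ∀ b : C × V, D (e, v) b =
      (if b.1 = e then if χ b.2 = e then D (e, v) (e, b.2) else 0 else 0) +
      if b.1 = χ v then if b.2 = v then
        (if S (χ v) then 0 else D (e, v) (χ v, v)) else 0 else 0 := by
    rintro ⟨e', w⟩
    by_cases h0 : D (e, v) (e', w) = 0
    · rw [h0]
      have h1 : e' = e → D (e, v) (e, w) = 0 := by rintro rfl; exact h0
      have h2 : e' = χ v → w = v → D (e, v) (χ v, v) = 0 := by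
        rintro rfl rfl; exact h0
      dsimp only
      grind
    · rcases hD _ _ h0 with (h | h) | (h | h)
      · exact absurd (hv.trans h.2.2.1) hp
      · obtain ⟨h1, h2, h3, h4⟩ := h
        simp only [Prod.mk.injEq] at h4
        obtain ⟨rfl, rfl⟩ := h4
        dsimp only at h1 h2 h3
        rw [h2]
        simp [h3, hp]
      · obtain ⟨h1, h2, h3, h4⟩ := h
        dsimp only at h1 h2 h3 h4
        subst h2
        have : e ≠ χ v := by rw [← hv]; exact hp.symm
        simp [h3, this]
      · obtain ⟨h1, h2, h3, h4⟩ := h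
        simp only [Prod.mk.injEq] at h4
        obtain ⟨h4, rfl⟩ := h4
        dsimp only at h1 h2 h3
        exact absurd (by rw [hv, h2, h4]) hp
  rw [Finset.sum_congr rfl fun b _ => key b, Finset.sum_add_distrib, Fintype.sum_prod_type, Fintype.sum_prod_type]
  congr 1
  · rw [Finset.sum_comm]
    simp [Finset.sum_filter]
  · rw [Finset.sum_comm]
    simp

open Classical in
theorem div_bottom (sk : Skeleton r S p ch hd lab depth) (hF : IsBalanced χ r p F U) (v : V)
    (hv : χ v ≠ r) :
    ∑ b, (arcWeight χ r S p F U (χ v, v) b - arcWeight χ r S p F U b (χ v, v)) =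
      if S (χ v) then U v else 0 := by
  rw [sum_bottom sk (D := fun a b => arcWeight χ r S p F U a b - arcWeight χ r S p F U b a)
    (fun a b => linked_of_div_ne) v hv]
  have h1 : ∑ v' with χ v' = p (χ v), (arcWeight χ r S p F U (χ v, v) (χ v, v') -
      arcWeight χ r S p F U (χ v, v') (χ v, v)) = U v := by
    rw [← hF.up v hv]
    refine Finset.sum_congr rfl fun v' hv' => ?_
    rw [Finset.mem_filter] at hv'
    rw [arcWeight_edge sk hv rfl hv'.2, arcWeight_edge_rev sk hv hv'.2, sub_zero]
  rw [h1]
  split_ifs with hS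
  · simp
  · rw [arcWeight_vertex sk (sk.ch_ne _ hS) (sk.p_ch _ hS) hS,
      arcWeight_vertex_rev sk (sk.ch_ne _ hS) (sk.p_ch _ hS) hS]
    simp

open Classical in
theorem div_top (sk : Skeleton r S p ch hd lab depth) (hF : IsBalanced χ r p F U) (v : V)
    (e : C) (he : e ≠ r) (hv : p e = χ v) :
    ∑ b, (arcWeight χ r S p F U (e, v) b - arcWeight χ r S p F U b (e, v)) =
      if S (χ v) then - U v else 0 := by
  rw [sum_top sk (D := fun a b => arcWeight χ r S p F U a b - arcWeight χ r S p F U b a)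
    (fun a b => linked_of_div_ne) v e he hv]
  have h1 : ∑ v' with χ v' = e, (arcWeight χ r S p F U (e, v) (e, v') -
      arcWeight χ r S p F U (e, v') (e, v)) = - U v := by
    rw [← hF.down v e he hv, ← Finset.sum_neg_distrib]
    refine Finset.sum_congr rfl fun v' hv' => ?_
    rw [Finset.mem_filter] at hv'
    rw [arcWeight_edge sk he hv'.2 hv.symm, arcWeight_edge_rev sk he hv.symm, zero_sub]
  rw [h1]
  split_ifs with hS
  · simp
  · rw [arcWeight_vertex sk he hv hS, arcWeight_vertex_rev sk he hv hS]
    simp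

theorem sum_ite_node (R : Finset (C × V)) (e c : C) (y : V → ℤ) :
    ∑ q ∈ R, (if q.1 = e ∧ χ q.2 = c then y q.2 else 0) =
      ∑ v with χ v = c, if (e, v) ∈ R then y v else 0 := by
  have h : ∀ q : C × V, (if q ∈ R then (if q.1 = e ∧ χ q.2 = c then y q.2 else 0) else 0) =
      if q.1 = e then (if χ q.2 = c then (if (e, q.2) ∈ R then y q.2 else 0) else 0) else 0 := by
    rintro ⟨e', v⟩
    by_cases he : e' = e
    · subst he
      by_cases hc : χ v = c <;> simp [hc]
    · simp [he]
  have hR : R = Finset.univ.filter fun q => q ∈ R := by simp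
  rw [hR, Finset.sum_filter, ← hR, Finset.sum_congr rfl fun q _ => h q, Fintype.sum_prod_type,
    Finset.sum_comm, Finset.sum_filter]
  simp

open Classical in
/-- Along each segment, all but a few tokens of the lower class can be matched to tokens of the
upper class between which the packing can be augmented. -/
theorem exists_transport {G : SimpleGraph V} (sk : Skeleton r S p ch hd lab depth) {k K n : ℕ}
    (hF : IsPacking G χ r p k F U)
    (hμ : IsFractional G χ r p K μ ν) {b : C} (hb : b ≠ r) (hSb : S b) (π : C → Fin n → V)
    (hπ : ∀ c i, χ (π c i) = c)
    (hfib : ∀ v, ((Finset.univ.filter fun i => π (χ v) i = v).card : ℤ) = ν v) :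
    ∃ θ : Equiv.Perm (Fin n), (Finset.univ.filter fun i => ¬ (U (π b i) = 0 ∧
      U (π (p (hd b)) (θ i)) = 0 ∧ Relation.ReflTransGen (Residual χ r S p K F μ U ν)
        (b, π b i) (hd b, π (p (hd b)) (θ i)))).card ≤ k * K := by
  refine exists_perm_of_deficiency (fun i j => U (π b i) = 0 ∧
      U (π (p (hd b)) j) = 0 ∧ Relation.ReflTransGen (Residual χ r S p K F μ U ν)
        (b, π b i) (hd b, π (p (hd b)) j)) fun P => ?_
  set Q := Finset.univ.filter fun j => ∃ i ∈ P, U (π b i) = 0 ∧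
      U (π (p (hd b)) j) = 0 ∧ Relation.ReflTransGen (Residual χ r S p K F μ U ν)
        (b, π b i) (hd b, π (p (hd b)) j) with hQ
  have hlab : lab b = b := sk.lab_self b hSb
  let R : Finset (C × V) := Finset.univ.filter fun q => ∃ i ∈ P, U (π b i) = 0 ∧
    Relation.ReflTransGen (Residual χ r S p K F μ U ν) (b, π b i) q
  have hRmem : ∀ q, q ∈ R ↔ ∃ i ∈ P, U (π b i) = 0 ∧
    Relation.ReflTransGen (Residual χ r S p K F μ U ν) (b, π b i) q := by simp [R]
  have h := sum_div_le_zero (arcWeight χ r S p (fun v v' => μ v v' - K * F v v')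
    (fun v => ν v - K * U v)) R (by
      intro q hq q' hq'
      rw [hRmem] at hq ⊢
      obtain ⟨i, hi, hU, hr⟩ := hq
      exact ⟨i, hi, hU, hr.tail hq'⟩)
  have hbal := hμ.balanced.sub_mul hF.balanced K
  have hdiv : ∀ q ∈ R, ∑ b, (arcWeight χ r S p (fun v v' => μ v v' - K * F v v')
      (fun v => ν v - K * U v) q b - arcWeight χ r S p (fun v v' => μ v v' - K * F v v')
      (fun v => ν v - K * U v) b q) =
      (if q.1 = b ∧ χ q.2 = b then ν q.2 - K * U q.2 else 0) -
      if q.1 = hd b ∧ χ q.2 = p (hd b) then ν q.2 - K * U q.2 else 0 := by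
    rintro ⟨e, v⟩ hq
    obtain ⟨i, hi, hU, hr⟩ := (hRmem _).1 hq
    obtain ⟨h1, h2, h3⟩ := labels_of_reflTransGen sk hr hb
    dsimp only at h1 h2 h3
    rw [hlab] at h2
    by_cases hc : χ v = e
    · subst hc
      rw [div_bottom sk hbal v h1]
      have hne : ¬ (χ v = hd b ∧ χ v = p (hd b)) := by
        rintro ⟨h4, h5⟩
        exact sk.p_ne (sk.hd_ne b hb) (h5.symm.trans h4)
      have hiff : S (χ v) ↔ χ v = b :=
        ⟨fun h => (sk.lab_self _ h).symm.trans h2, fun h => h ▸ hSb⟩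
      simp [hne, hiff]
    · have hne : ¬ (e = b ∧ χ v = b) := by
        rintro ⟨h4, h5⟩
        exact hc (h5.trans h4.symm)
      by_cases hc' : p e = χ v
      · rw [div_top sk hbal v e h1 hc']
        have hiff : S (χ v) ↔ (e = hd b ∧ χ v = p (hd b)) := by
          constructor
          · intro h
            have : hd e = e := sk.hd_top e h1 (hc' ▸ h)
            have : e = hd b := this.symm.trans h3
            exact ⟨this, by rw [← this, hc']⟩
          · rintro ⟨-, h5⟩
            rw [h5]
            exact sk.S_p_hd b hb
        simp only [hne, if_false, hiff]
        split_ifs <;> simp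
      · have hne' : ¬ (e = hd b ∧ χ v = p (hd b)) := by
          rintro ⟨h4, h5⟩
          exact hc' (by rw [h5, h4])
        simp only [hne, hne', if_false, sub_zero]
        refine Finset.sum_eq_zero fun q' _ => ?_
        by_contra hcon
        rcases (linked_of_div_ne hcon).color with h4 | h4
        · exact hc h4
        · exact hc' h4.symm
  rw [Finset.sum_congr rfl hdiv, Finset.sum_sub_distrib,
    sum_ite_node R b b fun v => ν v - K * U v,
    sum_ite_node R (hd b) (p (hd b)) fun v => ν v - K * U v] at h
  have hP : (P.card : ℤ) ≤ ∑ v with χ v = b,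
      ((if (b, v) ∈ R ∧ U v = 0 then ν v else 0) + U v * ν v) := by
    rw [Finset.card_eq_sum_card_fiberwise (f := π b) (t := Finset.univ.filter fun v => χ v = b)
      (by intro i _; simp [hπ])]
    push_cast
    refine Finset.sum_le_sum fun v hv => ?_
    rw [Finset.mem_filter] at hv
    have hle : ((P.filter fun i => π b i = v).card : ℤ) ≤ ν v := by
      rw [← hfib v, hv.2]
      exact_mod_cast Finset.card_le_card (Finset.filter_subset_filter _ (Finset.subset_univ _))
    have hν := hμ.ν_nonneg v
    rcases (P.filter fun i => π b i = v).eq_empty_or_nonempty with h0 | ⟨i, hi⟩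
    · rw [h0]
      have := mul_nonneg (hF.U_nonneg v) hν
      split_ifs <;> simp <;> linarith
    · rw [Finset.mem_filter] at hi
      have h1 := hF.U_nonneg v
      have h2 := hF.U_le_one v
      by_cases hU : U v = 0
      · have : (b, v) ∈ R := (hRmem _).2 ⟨i, hi.1, by rw [hi.2, hU], by rw [hi.2]⟩
        simp [this, hU, hle]
      · have : U v = 1 := by omega
        simp [this, hle]
  have hk : ∑ v with χ v = b, U v = k := (hF.balanced.sum_class sk b).trans hF.count
  have hA : (P.card : ℤ) - k * K ≤
      ∑ v with χ v = b, if (b, v) ∈ R then ν v - K * U v else 0 := by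
    rw [← hk, Finset.sum_mul]
    refine (sub_le_sub_right hP _).trans ?_
    rw [← Finset.sum_sub_distrib]
    refine Finset.sum_le_sum fun v _ => ?_
    have h1 := hF.U_nonneg v
    have h2 := hF.U_le_one v
    have h3 := hμ.ν_le v
    obtain hU | hU : U v = 0 ∨ U v = 1 := by omega
    · simp [hU]
    · simp only [hU]
      split_ifs <;> simp_all
  have hB : (∑ v with χ v = p (hd b), if (hd b, v) ∈ R then ν v - K * U v else 0) ≤
      (Q.card : ℤ) := by
    rw [Finset.card_eq_sum_card_fiberwise (f := π (p (hd b)))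
      (t := Finset.univ.filter fun v => χ v = p (hd b)) (by intro i _; simp [hπ])]
    push_cast
    refine Finset.sum_le_sum fun v hv => ?_
    rw [Finset.mem_filter] at hv
    have h1 := hF.U_nonneg v
    have h2 := hF.U_le_one v
    have h3 := hμ.ν_le v
    obtain hU | hU : U v = 0 ∨ U v = 1 := by omega
    · split_ifs with hR
      · rw [hU, mul_zero, sub_zero, ← hfib v, hv.2]
        refine Nat.cast_le.2 (Finset.card_le_card fun j hj => ?_)
        rw [Finset.mem_filter] at hj ⊢
        refine ⟨?_, hj.2⟩
        obtain ⟨i, hi, hU', hr⟩ := (hRmem _).1 hR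
        rw [hQ, Finset.mem_filter]
        exact ⟨Finset.mem_univ _, i, hi, hU', by rw [hj.2, hU], by rw [hj.2]; exact hr⟩
      · positivity
    · rw [hU]
      have : (0 : ℤ) ≤ ((Q.filter fun i => π (p (hd b)) i = v).card : ℤ) := by positivity
      split_ifs <;> linarith
  have : (P.card : ℤ) ≤ Q.card + k * K := by linarith
  exact_mod_cast this

open Classical in
/-- Augmenting a packing simultaneously along all segments. -/
theorem IsPacking.augment {G : SimpleGraph V} (sk : Skeleton r S p ch hd lab depth) {k K : ℕ}
    (hF : IsPacking G χ r p k F U) (hμ : IsFractional G χ r p K μ ν) (x : C → V)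
    (hx : ∀ c, S c → χ (x c) = c) (hU : ∀ c, S c → U (x c) = 0)
    (hreach : ∀ b, b ≠ r → S b → Relation.ReflTransGen (Residual χ r S p K F μ U ν)
      (b, x b) (hd b, x (p (hd b)))) :
    ∃ F' U', IsPacking G χ r p (k + 1) F' U' := by
  choose! H hH hdiv using fun b hb hS => exists_unit_flow _ (hreach b hb hS)
  let D : C → C × V → C × V → ℤ := fun b q q' => H b q q' - H b q' q
  have hD : ∀ b, b ≠ r → S b → ∀ q q', D b q q' ≠ 0 → Linked χ r S p q q' := by
    intro b hb hS q q' hne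
    rcases hH b hb hS q q' with h1 | ⟨-, h1⟩
    · rcases hH b hb hS q' q with h2 | ⟨-, h2⟩
      · simp [D, h1, h2] at hne
      · exact Or.symm h2.linked
    · exact h1.linked
  have hedge : ∀ v v', χ v ≠ r → χ v' = p (χ v) →
      0 ≤ F v v' + D (lab (χ v)) (χ v, v) (χ v, v') ∧
      (F v v' + D (lab (χ v)) (χ v, v) (χ v, v') ≠ 0 → G.Adj v v') := by
    intro v v' hv hv'
    have hF0 := hF.F_nonneg v v'
    have hμ0 := hμ.μ_nonneg v v'
    have hFadj := hF.F_adj v v'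
    have hKF : 0 ≤ K * F v v' := by positivity
    rcases hH _ (sk.lab_ne _ hv) (sk.S_lab _) (χ v, v) (χ v, v') with h1 | ⟨h1, h1'⟩ <;>
    rcases hH _ (sk.lab_ne _ hv) (sk.S_lab _) (χ v, v') (χ v, v) with h2 | ⟨h2, h2'⟩
    · simpa [D, h1, h2] using ⟨hF0, hFadj⟩
    · have h3 := residual_edge_rev sk hv hv' h2'
      have h4 : F v v' ≠ 0 := by
        intro h0
        rw [h0] at h3
        simp at h3
        omega
      simp only [D, h1, h2]
      exact ⟨by omega, fun _ => hFadj h4⟩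
    · have h3 := residual_edge sk hv hv' h1'
      simp only [D, h1, h2]
      exact ⟨by omega, fun _ => hμ.μ_adj _ _ (by omega)⟩
    · have h3 := residual_edge sk hv hv' h1'
      simp only [D, h1, h2]
      exact ⟨by omega, fun _ => hμ.μ_adj _ _ (by omega)⟩
  have hvert : ∀ v, ¬ S (χ v) → 0 ≤ U v - D (lab (χ v)) (χ v, v) (ch (χ v), v) ∧
      U v - D (lab (χ v)) (χ v, v) (ch (χ v), v) ≤ 1 := by
    intro v hS
    have hv := sk.ne_root hS
    have hU0 := hF.U_nonneg v
    have hU1 := hF.U_le_one v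
    have hν0 := hμ.ν_nonneg v
    have hν1 := hμ.ν_le v
    have hUcases : U v = 0 ∨ U v = 1 := by omega
    have hr1 : Residual χ r S p K F μ U ν (ch (χ v), v) (χ v, v) → U v = 0 := by
      intro h
      have := residual_vertex sk hS h
      rcases hUcases with h0 | h0
      · exact h0
      · rw [h0] at this; omega
    have hr2 : Residual χ r S p K F μ U ν (χ v, v) (ch (χ v), v) → U v = 1 := by
      intro h
      have := residual_vertex_rev sk hS h
      rcases hUcases with h0 | h0
      · rw [h0] at this; omega
      · exact h0
    rcases hH _ (sk.lab_ne _ hv) (sk.S_lab _) (χ v, v) (ch (χ v), v) with h1 | ⟨h1, h1'⟩ <;>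
    rcases hH _ (sk.lab_ne _ hv) (sk.S_lab _) (ch (χ v), v) (χ v, v) with h2 | ⟨h2, h2'⟩
    · simp only [D, h1, h2]; omega
    · have := hr1 h2'
      simp only [D, h1, h2]; omega
    · have := hr2 h1'
      simp only [D, h1, h2]; omega
    · have := hr1 h2'
      simp only [D, h1, h2]; omega
  let F' : V → V → ℤ := fun v v' =>
    if χ v ≠ r ∧ χ v' = p (χ v) then F v v' + D (lab (χ v)) (χ v, v) (χ v, v') else F v v'
  let U' : V → ℤ := fun v =>
    if S (χ v) then U v + (if v = x (χ v) then 1 else 0)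
    else U v - D (lab (χ v)) (χ v, v) (ch (χ v), v)
  refine ⟨F', U', ⟨?_, ?_⟩, ?_, ?_, ?_, ?_, ?_⟩
  · intro v hv
    have hb := sk.lab_ne _ hv
    have hS := sk.S_lab (χ v)
    have h1 := sum_bottom sk (hD _ hb hS) v hv
    rw [hdiv _ hb hS] at h1
    have h2 : ∑ v' with χ v' = p (χ v), F' v v' = U v +
        ∑ v' with χ v' = p (χ v), D (lab (χ v)) (χ v, v) (χ v, v') := by
      rw [← hF.balanced.up v hv, ← Finset.sum_add_distrib]
      refine Finset.sum_congr rfl fun v' hv' => ?_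
      simp [F', hv, (Finset.mem_filter.1 hv').2]
    have h3 : (χ v, v) ≠ (hd (lab (χ v)), x (p (hd (lab (χ v))))) := by
      intro h
      rw [Prod.mk.injEq] at h
      have h4 := hx _ (sk.S_p_hd _ hb)
      exact sk.p_ne (sk.hd_ne _ hb) (h4.symm.trans ((congrArg χ h.2.symm).trans h.1))
    rw [if_neg h3, sub_zero] at h1
    rw [h2]
    by_cases hSv : S (χ v)
    · simp only [sk.lab_self _ hSv, Prod.mk.injEq, true_and, hSv, if_true, add_zero] at h1
      simp only [U', hSv, if_true, sk.lab_self _ hSv, h1]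
    · have h5 : (χ v, v) ≠ (lab (χ v), x (lab (χ v))) := by
        intro h
        rw [Prod.mk.injEq] at h
        exact hSv (h.1 ▸ hS)
      rw [if_neg h5, if_neg hSv] at h1
      simp only [U', hSv, if_false]
      linarith
  · intro v d hd' hpd
    have hb := sk.lab_ne _ hd'
    have hS := sk.S_lab d
    have h1 := sum_top sk (hD _ hb hS) v d hd' hpd
    rw [hdiv _ hb hS] at h1
    have h2 : ∑ v' with χ v' = d, F' v' v = U v -
        ∑ v' with χ v' = d, D (lab d) (d, v) (d, v') := by
      rw [← hF.balanced.down v d hd' hpd, ← Finset.sum_sub_distrib]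
      refine Finset.sum_congr rfl fun v' hv' => ?_
      simp [F', hd', (Finset.mem_filter.1 hv').2, hpd, D]
      ring
    have h3 : (d, v) ≠ (lab d, x (lab d)) := by
      intro h
      rw [Prod.mk.injEq] at h
      have h4 := hx _ hS
      rw [← h.2, ← h.1, ← hpd] at h4
      exact sk.p_ne hd' h4
    rw [if_neg h3, sk.hd_lab d hd'] at h1
    rw [h2]
    by_cases hSv : S (χ v)
    · have hdd : hd d = d := sk.hd_top d hd' (hpd ▸ hSv)
      simp only [hdd, Prod.mk.injEq, true_and, hSv, if_true, add_zero, hpd] at h1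
      simp only [U', hSv, if_true]
      linarith
    · have hch : d = ch (χ v) := sk.ch_unique _ _ hSv hd' hpd
      have h5 : (d, v) ≠ (hd d, x (p (hd d))) := by
        intro h
        rw [Prod.mk.injEq] at h
        have := sk.S_p_hd d hd'
        rw [← h.1, hpd] at this
        exact hSv this
      rw [if_neg h5, if_neg hSv] at h1
      have h6 : lab (χ v) = lab d := by rw [sk.lab_step _ hSv, hch]
      have h7 : D (lab d) (χ v, v) (d, v) = - D (lab d) (d, v) (χ v, v) := by simp [D]
      simp only [U', hSv, if_false, h6, ← hch, h7]
      linarith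
  · intro v v'
    simp only [F']
    split_ifs with h
    · exact (hedge v v' h.1 h.2).1
    · exact hF.F_nonneg v v'
  · intro v v'
    simp only [F']
    split_ifs with h
    · exact (hedge v v' h.1 h.2).2
    · exact hF.F_adj v v'
  · intro v
    have := hF.U_nonneg v
    simp only [U']
    split_ifs with h h'
    · omega
    · omega
    · exact (hvert v h).1
  · intro v
    have := hF.U_le_one v
    simp only [U']
    split_ifs with h h'
    · have := hU _ h
      rw [← h'] at this
      omega
    · omega
    · exact (hvert v h).2
  · have h1 : ∀ v ∈ Finset.univ.filter (fun v => χ v = r),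
        U' v = U v + if v = x r then 1 else 0 := by
      intro v hv
      have := (Finset.mem_filter.1 hv).2
      simp [U', this, sk.S_root]
    rw [Finset.sum_congr rfl h1, Finset.sum_add_distrib, hF.count]
    simp [hx r sk.S_root]

open Classical in
/-- A packing smaller than the least class size divided by the number of special colors can be
enlarged. -/
theorem IsPacking.exists_succ {G : SimpleGraph V} (sk : Skeleton r S p ch hd lab depth)
    {k K m n : ℕ} (hF : IsPacking G χ r p k F U) (hμ : IsFractional G χ r p K μ ν) (s : C → ℕ)
    (hs : ∀ v, ν v = s (χ v)) (hcls : ∀ c, n = (Finset.univ.filter fun v => χ v = c).card * s c)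
    (hn : 0 < n) (hKm : K * m = n) (hk : (Finset.univ.filter S).card * k < m) :
    ∃ F' U', IsPacking G χ r p (k + 1) F' U' := by
  choose π hπ hfib using fun c => exists_balanced_map _ n (s c) (hcls c)
  have hπ' : ∀ c i, χ (π c i) = c := fun c i => (Finset.mem_filter.1 (hπ c i)).2
  have hfib' : ∀ v, ((Finset.univ.filter fun i => π (χ v) i = v).card : ℤ) = ν v := by
    intro v
    rw [hfib (χ v) v (by simp), hs v]
  choose! θ hθ using fun b hb hS => exists_transport sk hF hμ (b := b) hb hS π hπ' hfib'
  have hroot : (Finset.univ.filter fun i => U (π r i) ≠ 0).card ≤ k * K := by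
    suffices h : ((Finset.univ.filter fun i => U (π r i) ≠ 0).card : ℤ) ≤ k * K by
      exact_mod_cast h
    rw [Finset.card_eq_sum_card_fiberwise (f := π r)
      (t := Finset.univ.filter fun v => χ v = r) (by intro i _; simp [hπ']), ← hF.count,
      Finset.sum_mul]
    push_cast
    refine Finset.sum_le_sum fun v hv => ?_
    have hv := (Finset.mem_filter.1 hv).2
    have h1 := hF.U_nonneg v
    have h2 := hF.U_le_one v
    obtain hU | hU : U v = 0 ∨ U v = 1 := by omega
    · rw [hU, zero_mul, Finset.filter_filter, Finset.filter_eq_empty_iff.2]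
      · simp
      · rintro i - ⟨h3, h4⟩
        rw [h4] at h3
        exact h3 hU
    · rw [hU, one_mul]
      refine le_trans ?_ (hμ.ν_le v)
      rw [← hfib' v, hv]
      exact_mod_cast Finset.card_le_card (Finset.filter_subset_filter _ (Finset.subset_univ _))
  obtain ⟨τ, -, hτ⟩ := exists_recursive depth (· = r) (fun c => p (hd c))
    (fun c => sk.depth_up) (fun _ => (1 : Equiv.Perm (Fin n))) (fun c t => t.trans (θ c).symm)
  let bad : C → Finset (Fin n) := fun c => if c = r then Finset.univ.filter fun i => U (π r i) ≠ 0
    else Finset.univ.filter fun i => ¬ (U (π c i) = 0 ∧ U (π (p (hd c)) (θ c i)) = 0 ∧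
      Relation.ReflTransGen (Residual χ r S p K F μ U ν) (c, π c i)
        (hd c, π (p (hd c)) (θ c i)))
  have hbad : ∀ c, S c → (bad c).card ≤ k * K := by
    intro c hS
    by_cases hc : c = r
    · simpa only [bad, hc, if_true] using hroot
    · simpa only [bad, hc, if_false] using hθ c hc hS
  have hlt : ((Finset.univ.filter S).biUnion fun c => (bad c).map (τ c).symm.toEmbedding).card <
      (Finset.univ : Finset (Fin n)).card := by
    refine (Finset.card_biUnion_le_card_mul _ _ (k * K) fun c hc => ?_).trans_lt ?_
    · rw [Finset.card_map]
      exact hbad c (Finset.mem_filter.1 hc).2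
    · rw [Finset.card_univ, Fintype.card_fin, ← hKm, ← mul_assoc, mul_comm K]
      have hK : 0 < K := Nat.pos_of_ne_zero fun h => by simp [h] at hKm; omega
      exact Nat.mul_lt_mul_of_pos_right hk hK
  obtain ⟨i, -, hi⟩ := Finset.exists_mem_notMem_of_card_lt_card hlt
  have hgood : ∀ c, S c → τ c i ∉ bad c := by
    intro c hS hb
    refine hi (Finset.mem_biUnion.2 ⟨c, by simp [hS], Finset.mem_map.2 ⟨τ c i, hb, by simp⟩⟩)
  have hgood' : ∀ c, c ≠ r → S c → U (π c (τ c i)) = 0 ∧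
      Relation.ReflTransGen (Residual χ r S p K F μ U ν) (c, π c (τ c i))
        (hd c, π (p (hd c)) (τ (p (hd c)) i)) := by
    intro c hc hS
    have h := hgood c hS
    have h1 : θ c (τ c i) = τ (p (hd c)) i := by simp [hτ c hc]
    simp only [bad, hc, if_false, Finset.mem_filter, Finset.mem_univ, true_and, not_not, h1] at h
    exact ⟨h.1, h.2.2⟩
  refine hF.augment sk hμ (fun c => π c (τ c i)) (fun c _ => hπ' _ _) (fun c hS => ?_)
    fun b hb hS => (hgood' b hb hS).2
  by_cases hc : c = r
  · subst hc
    simpa [bad] using hgood c hS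
  · exact (hgood' c hc hS).1

end Flow

end TreePacking

open TreePacking

/-- Let `χ : V(G) → C` be a CR-stable coloring of a finite graph `G` and
let `T` be a tree with vertex set `C` such that every edge of `T` is realized by an edge of
`G` between the corresponding color classes. Let `m` be the minimum size of a color class
and `ℓ = 2·|V_{≤1}(T)| + |V_{≥3}(T)|`. Then there are at least `⌊m / ℓ⌋` pairwise
vertex-disjoint subtrees of `G` that agree with `T` (a subgraph agrees with `T` if `χ`
restricted to it is an isomorphism onto `T`; such a subgraph is given by a system of
representatives `f : C → V` with `χ (f c) = c` realizing all edges of `T`). -/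
theorem disjoint_trees_agreeing_with_tree
    (V C : Type) [Fintype V] [Fintype C] (G : SimpleGraph V) (χ : V → C)
    (hstable : IsCRStableColoring G χ)
    (T : SimpleGraph C) (hT : T.IsTree)
    (hedges : ∀ c₁ c₂ : C, T.Adj c₁ c₂ →
      ∃ v₁ v₂ : V, χ v₁ = c₁ ∧ χ v₂ = c₂ ∧ G.Adj v₁ v₂) :
    ∃ f : Fin ((⨅ c : C, (χ ⁻¹' {c}).ncard) /
        (2 * {c : C | {x | T.Adj c x}.ncard ≤ 1}.ncard +
          {c : C | 3 ≤ {x | T.Adj c x}.ncard}.ncard)) → C → V,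
      (∀ j c, χ (f j c) = c) ∧
      (∀ j c c', T.Adj c c' → G.Adj (f j c) (f j c')) ∧
      (∀ j j', j ≠ j' → Disjoint (Set.range (f j)) (Set.range (f j'))) := by
  classical
  have hne := hT.1.nonempty
  set m := ⨅ c : C, (χ ⁻¹' {c}).ncard
  set L := {c : C | {x | T.Adj c x}.ncard ≤ 1}.ncard
  set B := {c : C | 3 ≤ {x | T.Adj c x}.ncard}.ncard
  have hncard : ∀ c, (χ ⁻¹' {c}).ncard = (Finset.univ.filter fun v => χ v = c).card := by
    intro c
    rw [← Set.ncard_coe_finset]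
    congr 1
    ext v
    simp
  have hmin : ∀ c, m ≤ (Finset.univ.filter fun v => χ v = c).card := fun c =>
    hncard c ▸ ciInf_le' _ c
  obtain ⟨c₀, hc₀⟩ := exists_eq_ciInf_of_finite (f := fun c : C => (χ ⁻¹' {c}).ncard)
  rw [hncard] at hc₀
  obtain ⟨r, hr⟩ := exists_ncard_adj_le_one T hT
  obtain ⟨p, depth, hdepth, hadj, hpar⟩ := exists_parent T hT r
  let S : C → Prop := fun c => {x | T.Adj c x}.ncard ≤ 1 ∨ 3 ≤ {x | T.Adj c x}.ncard
  have hScard : (Finset.univ.filter S).card ≤ 2 * L + B := by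
    have h : (Finset.univ.filter S).card ≤ L + B := by
      rw [← Set.ncard_coe_finset]
      refine le_trans (le_of_eq ?_) (Set.ncard_union_le _ _)
      congr 1
      ext c
      simp [S]
    omega
  obtain ⟨ch, hd, lab, sk⟩ := exists_skeleton r S p depth (Or.inl hr) hdepth fun c hS =>
    exists_unique_child T r p depth hdepth hadj hpar hr c (by simp only [S] at hS; omega)
  have hpack : ∀ k, k ≤ m / (2 * L + B) → ∃ F U, IsPacking G χ r p k F U := by
    intro k
    induction k with
    | zero => exact fun _ => ⟨_, _, IsPacking.empty G⟩
    | succ k ih =>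
      intro hk
      obtain ⟨F, U, hF⟩ := ih (by omega)
      have hl : 0 < 2 * L + B := Nat.pos_of_ne_zero fun h => by simp [h] at hk
      have hk' := (Nat.le_div_iff_mul_le hl).1 hk
      have hklt : (Finset.univ.filter S).card * k < m := by
        have := Nat.mul_le_mul_right k hScard
        rw [Nat.succ_mul, mul_comm k] at hk'
        omega
      obtain ⟨n, K, μ, ν, s, hμ, hs, hcls, hn, hKm⟩ := exists_fractional G χ
        (fun v w h c => by
          have := hstable v w h c
          rw [Set.ncard_eq_toFinset_card', Set.ncard_eq_toFinset_card'] at this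
          convert this using 2 <;> ext <;> simp)
        r p (fun c hc => hedges _ _ (hadj c hc)) m (by omega) c₀ hc₀ hmin
      exact hF.exists_succ sk hμ s hs hcls hn hKm (by convert hklt)
  obtain ⟨F, U, hF⟩ := hpack _ le_rfl
  obtain ⟨f, hf1, hf2, hf3⟩ := hF.exists_copies sk
  refine ⟨f, hf1, fun j c c' h => ?_, fun j j' hjj' => ?_⟩
  · rcases hpar c c' h with ⟨hc, rfl⟩ | ⟨hc, rfl⟩
    · exact hf2 j c hc
    · exact (hf2 j c' hc).symm
  · rw [Set.disjoint_left]
    rintro _ ⟨c, rfl⟩ ⟨c', hcc'⟩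
    have : c' = c := by rw [← hf1 j' c', hcc', hf1]
    subst this
    exact hjj' (hf3 c' _ _ hcc'.symm)
end

section
/- Let h ∈ ℕ and t ≥ 3h³. Let G be a finite graph that excludes the complete graph K_h as a topological subgraph, let X ⊆ V(G), and let Z be the vertex set of a connected component of G − cl_t^G(X). Then |N_G(Z)| < h. -/
/-- An equivalence relation `r` on the vertices of a vertex- and arc-colored graph is stable
with respect to the Color Refinement algorithm: equivalent vertices have, for every class
(represented by `u₀`) and every pair of arc colors `(a, b)`, equally many neighbors in that
class joined by arcs of colors `a` (outgoing) and `b` (incoming). -/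
def ArcCRStable {V C₂ : Type*} (G : SimpleGraph V) (χE : V → V → C₂)
    (r : V → V → Prop) : Prop :=
  ∀ v w, r v w → ∀ (u₀ : V) (a b : C₂),
    {u | G.Adj v u ∧ r u u₀ ∧ χE v u = a ∧ χE u v = b}.ncard =
      {u | G.Adj w u ∧ r u u₀ ∧ χE w u = a ∧ χE u w = b}.ncard

/-- All classes of `r` of size at most `t` are singletons. -/
def TDiscrete {V : Type*} (t : ℕ) (r : V → V → Prop) : Prop :=
  ∀ v, {w | r v w}.ncard ≤ t → ∀ w, r v w → w = v

/-- The partition corresponding to the initial coloring for computing the `t`-closure of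
`X`: it refines the vertex coloring `χV` and additionally gives every vertex of `X` its own
singleton color. -/
def InitPartition {V C₁ : Type*} (χV : V → C₁) (X : Set V) (v w : V) : Prop :=
  χV v = χV w ∧ (v ∈ X → v = w) ∧ (w ∈ X → v = w)

/-- `r` is (the partition of) the `t`-CR-stable coloring of the vertex- and arc-colored
graph `(G, χV, χE)` obtained from the initial coloring that refines `χV` by individualizing
all vertices of `X`: it is the coarsest equivalence relation refining the initial one that is
stable under Color Refinement and all of whose classes of size at most `t` are singletons.
(This characterizes the result of the iterated refine-and-split process.) -/
def IsTCRStablePartition {V C₁ C₂ : Type*} (G : SimpleGraph V) (χV : V → C₁)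
    (χE : V → V → C₂) (t : ℕ) (X : Set V) (r : V → V → Prop) : Prop :=
  Equivalence r ∧ ArcCRStable G χE r ∧ TDiscrete t r ∧
    (∀ v w, r v w → InitPartition χV X v w) ∧
    ∀ s : V → V → Prop, Equivalence s → ArcCRStable G χE s → TDiscrete t s →
      (∀ v w, s v w → InitPartition χV X v w) → ∀ v w, s v w → r v w

/-- The `t`-closure `cl_t^G(X)` of a set `X` of vertices of the vertex- and arc-colored graph
`(G, χV, χE)`: the set of vertices whose class in the `t`-CR-stable coloring (computed after
individualizing all vertices of `X`) is a singleton. -/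
def tClosure {V C₁ C₂ : Type*} (G : SimpleGraph V) (χV : V → C₁) (χE : V → V → C₂)
    (t : ℕ) (X : Set V) : Set V :=
  {v | ∃ r, IsTCRStablePartition G χV χE t X r ∧ ∀ w, r v w → w = v}


/-- `H` is a topological subgraph of `G` (a subdivision of `H` is isomorphic to a subgraph
of `G`): there are an injective map `f` of branch vertices and, for each edge of `H`, a path
in `G` between the images of its endpoints, such that these paths have no branch vertices in
their interiors and paths of distinct edges share only common branch-vertex endpoints. -/
def HasTopologicalSubgraph {V W : Type*} (G : SimpleGraph V) (H : SimpleGraph W) : Prop :=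
  ∃ f : W → V, Function.Injective f ∧
    ∃ P : ∀ ⦃u v : W⦄, H.Adj u v → G.Walk (f u) (f v),
      (∀ u v (huv : H.Adj u v), (P huv).IsPath) ∧
      (∀ u v (huv : H.Adj u v) (w : W), f w ∈ (P huv).support → w = u ∨ w = v) ∧
      (∀ u v (huv : H.Adj u v) (u' v' : W) (hu'v' : H.Adj u' v'),
        (s(u, v) : Sym2 W) ≠ s(u', v') →
        ∀ x, x ∈ (P huv).support → x ∈ (P hu'v').support →
          (x = f u ∨ x = f v) ∧ (x = f u' ∨ x = f v'))

namespace ColorTree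

open scoped Classical in
theorem reach_first_step {α β : Type*} {E : α → β → Prop} {f : α → β} {L : Finset α} {b u : α}
    (h : Relation.ReflTransGen (fun v x => x ∈ L ∧ E v (f x)) b u) :
    u = b ∨ ∃ x ∈ L, E b (f x) ∧
      Relation.ReflTransGen (fun v y => y ∈ L.erase x ∧ E v (f y)) x u := by
  induction h with
  | refl => exact Or.inl rfl
  | @tail v w _ hvw ih =>
    right
    rcases ih with rfl | ⟨x, hx, hbx, hr⟩
    · exact ⟨w, hvw.1, hvw.2, .refl⟩
    · by_cases hwx : w = x
      · exact ⟨x, hx, hbx, hwx ▸ .refl⟩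
      · exact ⟨x, hx, hbx, hr.tail ⟨Finset.mem_erase.2 ⟨hwx, hvw.1⟩, hvw.2⟩⟩

open scoped Classical in
/-- Augmentation of a bipartite matching `f` of `L` along an alternating walk from the unmatched
vertex `b` to the unmatched vertex `r`. -/
theorem exists_augmented_matching {α β : Type*} {E : α → β → Prop} {f : α → β} {u : α} {r : β}
    (hur : E u r) (L : Finset α) (b : α) (hb : b ∉ L) (hinj : Set.InjOn f L)
    (hE : ∀ x ∈ L, E x (f x)) (hr : r ∉ L.image f)
    (h : Relation.ReflTransGen (fun v x => x ∈ L ∧ E v (f x)) b u) :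
    ∃ g : α → β, Set.InjOn g (insert b L : Finset α) ∧ (∀ x ∈ insert b L, E x (g x)) ∧
      (insert b L).image g = insert r (L.image f) := by
  induction L using Finset.strongInduction generalizing b with
  | H L ih =>
    have key : ∀ (g : α → β) (y : β), Set.InjOn g L → (∀ x ∈ L, E x (g x)) → y ∉ L.image g →
        E b y → ∃ g' : α → β, Set.InjOn g' (insert b L : Finset α) ∧
          (∀ x ∈ insert b L, E x (g' x)) ∧
          (insert b L).image g' = insert y (L.image g) := by
      intro g y h1 h2 h3 h4
      have hne : ∀ x ∈ L, Function.update g b y x = g x := fun x hx =>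
        Function.update_of_ne (by rintro rfl; exact hb hx) _ _
      refine ⟨Function.update g b y, ?_, ?_, ?_⟩
      · rw [Finset.coe_insert, Set.injOn_insert (by simpa using hb)]
        refine ⟨fun x hx z hz hxz => ?_, ?_⟩
        · rw [hne x hx, hne z hz] at hxz
          exact h1 hx hz hxz
        · rintro ⟨x, hx, hxy⟩
          rw [hne x hx, Function.update_self] at hxy
          exact h3 (Finset.mem_image.2 ⟨x, hx, hxy⟩)
      · intro x hx
        rcases Finset.mem_insert.1 hx with rfl | hx
        · simpa using h4
        · rw [hne x hx]; exact h2 x hx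
      · rw [Finset.image_insert, Function.update_self]
        congr 1
        exact Finset.image_congr hne
    rcases reach_first_step h with rfl | ⟨x, hx, hbx, hreach⟩
    · exact key f r hinj hE hr hur
    · obtain ⟨g, h1, h2, h3⟩ := ih (L.erase x) (Finset.erase_ssubset hx) x
        (Finset.notMem_erase x L) (hinj.mono (by simp))
        (fun y hy => hE y (Finset.mem_of_mem_erase hy))
        (fun hmem => hr (Finset.image_subset_image (Finset.erase_subset x L) hmem)) hreach
      rw [Finset.insert_erase hx] at h1 h2 h3
      have hfx : f x ∉ L.image g := by
        rw [h3, Finset.mem_insert]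
        rintro (h | h)
        · exact hr (h ▸ Finset.mem_image_of_mem f hx)
        · obtain ⟨y, hy, hyx⟩ := Finset.mem_image.1 h
          exact Finset.ne_of_mem_erase hy (hinj (Finset.mem_of_mem_erase hy) hx hyx)
      obtain ⟨g', h4, h5, h6⟩ := key g (f x) h1 h2 hfx hbx
      refine ⟨g', h4, h5, ?_⟩
      rw [h6, h3, Finset.insert_comm, ← Finset.image_insert, Finset.insert_erase hx]

open scoped Classical in
/-- The color class of `c`. -/
noncomputable def fiber {V ι : Type*} [Fintype V] (col : V → ι) (c : ι) : Finset V :=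
  Finset.univ.filter fun v => col v = c

@[simp] theorem mem_fiber {V ι : Type*} [Fintype V] {col : V → ι} {c : ι} {v : V} :
    v ∈ fiber col c ↔ col v = c := by simp [fiber]

/-- The coloring `col` of the vertices of `G` is stable. -/
def Equitable {V ι : Type*} (G : SimpleGraph V) (col : V → ι) : Prop :=
  ∀ v w, col v = col w → ∀ c, {u | G.Adj v u ∧ col u = c}.ncard = {u | G.Adj w u ∧ col u = c}.ncard

/-- Some vertex of color `i` is adjacent to some vertex of color `j`. -/
def ColorAdj {V ι : Type*} (G : SimpleGraph V) (col : V → ι) (i j : ι) : Prop :=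
  ∃ u v, G.Adj u v ∧ col u = i ∧ col v = j

theorem Equitable.density_le {V ι : Type*} [Fintype V] {G : SimpleGraph V} {col : V → ι}
    (hG : Equitable G col) {i j : ι} (hij : ColorAdj G col i j) {C N : Finset V}
    (hC : ∀ u ∈ C, col u = i) (hN : ∀ v ∈ N, col v = j)
    (hCN : ∀ u ∈ C, ∀ v, col v = j → G.Adj u v → v ∈ N) :
    (C.card : ℚ) / (fiber col i).card ≤ (N.card : ℚ) / (fiber col j).card := by
  classical
  obtain ⟨a, b, hab, rfl, rfl⟩ := hij
  set d := {u | G.Adj a u ∧ col u = col b}.ncard with hd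
  set e := {u | G.Adj b u ∧ col u = col a}.ncard with he
  have hdpos : 0 < d := (Set.ncard_pos (Set.toFinite _)).2 ⟨b, hab, rfl⟩
  have hepos : 0 < e := (Set.ncard_pos (Set.toFinite _)).2 ⟨a, hab.symm, rfl⟩
  have cardd : ∀ u, col u = col a →
      ((fiber col (col b)).bipartiteAbove G.Adj u).card = d := by
    intro u hu
    rw [hd, ← hG u a hu, ← Set.ncard_coe_finset]
    congr 1; ext v; simp [Finset.bipartiteAbove, and_comm]
  have carde : ∀ v, col v = col b →
      ((fiber col (col a)).bipartiteBelow G.Adj v).card = e := by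
    intro v hv
    rw [he, ← hG v b hv, ← Set.ncard_coe_finset]
    congr 1; ext u; simp [Finset.bipartiteBelow, and_comm, G.adj_comm]
  have h1 : (fiber col (col a)).card * d = (fiber col (col b)).card * e :=
    Finset.card_mul_eq_card_mul G.Adj (fun u hu => cardd u (mem_fiber.1 hu))
      (fun v hv => carde v (mem_fiber.1 hv))
  have h2 : C.card * d ≤ N.card * e := by
    refine Finset.card_mul_le_card_mul G.Adj (fun u hu => ?_) (fun v hv => ?_)
    · rw [← cardd u (hC u hu)]
      refine Finset.card_le_card fun v hv => ?_
      simp only [Finset.bipartiteAbove, Finset.mem_filter, mem_fiber] at hv ⊢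
      exact ⟨hCN u hu v hv.1 hv.2, hv.2⟩
    · rw [← carde v (hN v hv)]
      refine Finset.card_le_card fun u hu => ?_
      simp only [Finset.bipartiteBelow, Finset.mem_filter, mem_fiber] at hu ⊢
      exact ⟨hC u hu.1, hu.2⟩
  have ha : 0 < (fiber col (col a)).card := Finset.card_pos.2 ⟨a, by simp⟩
  have hb : 0 < (fiber col (col b)).card := Finset.card_pos.2 ⟨b, by simp⟩
  rw [div_le_div_iff₀ (by exact_mod_cast ha) (by exact_mod_cast hb)]
  have : C.card * (fiber col (col b)).card * e ≤ N.card * (fiber col (col a)).card * e := by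
    calc C.card * (fiber col (col b)).card * e
        = (C.card * d) * (fiber col (col a)).card := by rw [mul_assoc, ← h1]; ring
      _ ≤ (N.card * e) * (fiber col (col a)).card := Nat.mul_le_mul_right _ h2
      _ = _ := by ring
  exact_mod_cast Nat.le_of_mul_le_mul_right this hepos

open scoped Classical in
/-- The vertices in the inner layers of the sequence of color classes `A 0, …, A k`. -/
noncomputable def inner {V ι : Type*} [Fintype V] (col : V → ι) (A : ℕ → ι) (k : ℕ) : Finset V :=
  Finset.univ.filter fun v => ∃ j, 0 < j ∧ j < k ∧ col v = A j

@[simp] theorem mem_inner {V ι : Type*} [Fintype V] {col : V → ι} {A : ℕ → ι} {k : ℕ} {v : V} :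
    v ∈ inner col A k ↔ ∃ j, 0 < j ∧ j < k ∧ col v = A j := by simp [inner]

/-- The bipartite graph (between two copies of the vertex set) whose matchings describe linkages
through the layers `A 0, …, A k`: inner vertices may be idle, and all other edges go from one layer
to the next. -/
def Step {V ι : Type*} (G : SimpleGraph V) (col : V → ι) (A : ℕ → ι) (k : ℕ) (u v : V) : Prop :=
  (u = v ∧ ∃ j, 0 < j ∧ j < k ∧ col u = A j) ∨
    ∃ j < k, col u = A j ∧ col v = A (j + 1) ∧ G.Adj u v

open scoped Classical in
/-- `f` encodes a family of disjoint paths through the layers `A 0, …, A k` linking `X` to `Y`: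
it maps every vertex of a path to the next one and fixes the inner vertices on none of the paths. -/
structure IsLinkage {V ι : Type*} [Fintype V] (G : SimpleGraph V) (col : V → ι) (A : ℕ → ι)
    (k : ℕ) (X Y : Finset V) (f : V → V) : Prop where
  injOn : Set.InjOn f (X ∪ inner col A k : Finset V)
  step : ∀ x ∈ X ∪ inner col A k, Step G col A k x (f x)
  image : (X ∪ inner col A k).image f = inner col A k ∪ Y

section Linkage

variable {V ι : Type*} [Fintype V] {G : SimpleGraph V} {col : V → ι} {A : ℕ → ι} {k : ℕ}
  {X Y : Finset V} {f : V → V}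

theorem IsLinkage.card_eq (hf : IsLinkage G col A k X Y f)
    (hA : ∀ i ≤ k, ∀ j ≤ k, A i = A j → i = j) (hX : ∀ x ∈ X, col x = A 0)
    (hY : ∀ y ∈ Y, col y = A k) : X.card = Y.card := by
  classical
  have h1 : Disjoint X (inner col A k) := by
    rw [Finset.disjoint_left]
    rintro x hx hx'
    obtain ⟨j, hj, hjk, hxj⟩ := mem_inner.1 hx'
    have := hA 0 (by omega) j hjk.le ((hX x hx).symm.trans hxj)
    omega
  have h2 : Disjoint (inner col A k) Y := by
    rw [Finset.disjoint_right]
    rintro x hx hx'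
    obtain ⟨j, hj, hjk, hxj⟩ := mem_inner.1 hx'
    have := hA k le_rfl j hjk.le ((hY x hx).symm.trans hxj)
    omega
  have h3 := Finset.card_image_of_injOn hf.injOn
  rw [hf.image, Finset.card_union_of_disjoint, Finset.card_union_of_disjoint] at h3
  · omega
  · convert h1
  · convert h2

open scoped Classical in
theorem IsLinkage.exists_augment (hf : IsLinkage G col A k X Y f) (hG : Equitable G col)
    (hk : 0 < k) (hA : ∀ i ≤ k, ∀ j ≤ k, A i = A j → i = j)
    (hadj : ∀ j < k, ColorAdj G col (A j) (A (j + 1)))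
    {m : ℕ} (hm : 0 < m) (hAm : ∀ j ≤ k, m ≤ (fiber col (A j)).card)
    (hX : ∀ x ∈ X, col x = A 0) {B : Finset V} (hYB : Y ⊆ B) :
    ∃ B' : Finset V, X ⊆ B' ∧
      (∀ b, col b = A 0 → b ∉ B' → ∃ r, col r = A k ∧ r ∉ B ∧
        ∃ g, IsLinkage G col A k (insert b X) (insert r Y) g) ∧
      (B'.card : ℚ) / (fiber col (A 0)).card ≤ B.card / (fiber col (A k)).card + X.card / m := by
  set L := X ∪ inner col A k with hL
  obtain ⟨Good, hGood⟩ : ∃ Good : V → Prop, ∀ b, Good b ↔ ∃ r, col r = A k ∧ r ∉ B ∧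
    ∃ g, IsLinkage G col A k (insert b X) (insert r Y) g := ⟨_, fun _ => Iff.rfl⟩
  obtain ⟨C, hC⟩ : ∃ C : V → Prop, ∀ u, C u ↔ ∃ b, col b = A 0 ∧ b ∉ X ∧ ¬ Good b ∧
    Relation.ReflTransGen (fun v x => x ∈ L ∧ Step G col A k v (f x)) b u :=
      ⟨_, fun _ => Iff.rfl⟩
  have hCstep : ∀ {u z}, C u → z ∈ L → Step G col A k u (f z) → C z := by
    intro u z hu hz hs
    obtain ⟨b, h1, h2, h3, h4⟩ := (hC u).1 hu
    exact (hC z).2 ⟨b, h1, h2, h3, h4.tail ⟨hz, hs⟩⟩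
  -- a vertex of `C` has no neighbors in the last layer outside `B`
  have hClast : ∀ {u v}, C u → col v = A k → Step G col A k u v → v ∈ B := by
    intro u v hu hv hs
    obtain ⟨b, h1, h2, h3, h4⟩ := (hC u).1 hu
    by_contra hvB
    refine h3 ((hGood b).2 ⟨v, hv, hvB, ?_⟩)
    have hbL : b ∉ L := by
      rw [hL, Finset.mem_union, mem_inner]
      rintro (h | ⟨j, hj, hjk, hbj⟩)
      · exact h2 h
      · have := hA 0 (by omega) j hjk.le (h1.symm.trans hbj)
        omega
    have hvL : v ∉ L.image f := by
      rw [hf.image, Finset.mem_union, mem_inner]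
      rintro (⟨j, hj, hjk, hbj⟩ | h)
      · have := hA k le_rfl j hjk.le (hv.symm.trans hbj)
        omega
      · exact hvB (hYB h)
    obtain ⟨g, g1, g2, g3⟩ := exists_augmented_matching hs L b hbL hf.injOn hf.step hvL h4
    refine ⟨g, ?_, ?_, ?_⟩
    · rwa [Finset.insert_union]
    · rwa [Finset.insert_union]
    · rw [Finset.insert_union, g3, hf.image, Finset.union_insert]
  obtain ⟨Cj, hCj⟩ : ∃ F : ℕ → Finset V, ∀ j u, u ∈ F j ↔ C u ∧ col u = A j :=
    ⟨fun j => Finset.univ.filter fun u => C u ∧ col u = A j, by simp⟩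
  obtain ⟨P, hP⟩ : ∃ F : ℕ → Finset V, ∀ j u, u ∈ F j ↔ C u ∧ col u = A j ∧ u ∈ L ∧ f u ≠ u :=
    ⟨fun j => Finset.univ.filter fun u => C u ∧ col u = A j ∧ u ∈ L ∧ f u ≠ u, by simp⟩
  obtain ⟨N, hN⟩ : ∃ F : ℕ → Finset V, ∀ j v, v ∈ F j ↔ col v = A (j + 1) ∧
      ∃ u, C u ∧ col u = A j ∧ G.Adj u v :=
    ⟨fun j => Finset.univ.filter fun v => col v = A (j + 1) ∧
      ∃ u, C u ∧ col u = A j ∧ G.Adj u v, by simp⟩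
  have hCN : ∀ j < k, ((Cj j).card : ℚ) / (fiber col (A j)).card ≤
      (N j).card / (fiber col (A (j + 1))).card := by
    intro j hj
    refine hG.density_le (hadj j hj) (by simp [hCj]) (by simp +contextual [hN]) ?_
    intro u hu v hv huv
    rw [hCj] at hu
    rw [hN]
    exact ⟨hv, u, hu.1, hu.2, huv⟩
  -- a preimage under `f` of a vertex of an inner layer
  have hpre : ∀ j, j + 1 < k → ∀ y, col y = A (j + 1) →
      ∃ z ∈ L, f z = y ∧ (z = y ∨ col z = A j) := by
    intro j hj y hy
    have : y ∈ L.image f := by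
      rw [hf.image, Finset.mem_union, mem_inner]
      exact Or.inl ⟨j + 1, by omega, hj, hy⟩
    obtain ⟨z, hz, rfl⟩ := Finset.mem_image.1 this
    refine ⟨z, hz, rfl, ?_⟩
    rcases hf.step z hz with h | ⟨i, hi, h1, h2, -⟩
    · exact Or.inl h.1
    · right
      have := hA _ (by omega) _ (by omega) (h2.symm.trans hy)
      rw [h1]; congr 1; omega
  have hexit : ∀ j, j + 1 < k → (N j \ Cj (j + 1)).card + (P (j + 1)).card ≤ (P j).card := by
    intro j hj
    have hd : Disjoint (N j \ Cj (j + 1)) (P (j + 1)) := by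
      rw [Finset.disjoint_left]
      intro y hy hy'
      rw [Finset.mem_sdiff, hCj] at hy
      rw [hP] at hy'
      exact hy.2 ⟨hy'.1, hy'.2.1⟩
    rw [← Finset.card_union_of_disjoint hd]
    refine (Finset.card_le_card (t := (P j).image f) ?_).trans Finset.card_image_le
    intro y hy
    have hcol : col y = A (j + 1) := by
      rcases Finset.mem_union.1 hy with h | h <;>
        simp only [hCj, hN, hP, Finset.mem_sdiff] at h
      · exact h.1.1
      · exact h.2.1
    obtain ⟨z, hz, hzy, hzcol⟩ := hpre j hj y hcol
    have hzC : C z ∧ z ≠ y := by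
      rcases Finset.mem_union.1 hy with h | h <;>
        simp only [hCj, hN, hP, Finset.mem_sdiff] at h
      · obtain ⟨⟨-, u, hu, huj, huy⟩, hnot⟩ := h
        have hzC : C z := hCstep hu hz (Or.inr ⟨j, by omega, huj, hzy ▸ hcol, hzy ▸ huy⟩)
        exact ⟨hzC, fun h => hnot ⟨h ▸ hzC, hcol⟩⟩
      · refine ⟨hCstep h.1 hz (Or.inl ⟨hzy.symm, j + 1, by omega, hj, hcol⟩), ?_⟩
        rintro rfl
        exact h.2.2.2 hzy
    refine Finset.mem_image.2 ⟨z, ?_, hzy⟩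
    rw [hP]
    exact ⟨hzC.1, hzcol.resolve_left hzC.2, hz, fun h => hzC.2 (h.symm.trans hzy)⟩
  have hmQ : (0 : ℚ) < m := by exact_mod_cast hm
  have hinv : ∀ j < k, ((Cj 0).card : ℚ) / (fiber col (A 0)).card + (P j).card / m ≤
      (Cj j).card / (fiber col (A j)).card + (P 0).card / m := by
    intro j
    induction j with
    | zero => intro _; exact le_rfl
    | succ j ih =>
      intro hj
      have h1 := ih (by omega)
      have h2 := hCN j (by omega)
      have h3 : ((N j).card : ℚ) ≤ (N j \ Cj (j + 1)).card + (Cj (j + 1)).card := by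
        have := Finset.card_le_card_sdiff_add_card (s := N j) (t := Cj (j + 1))
        exact_mod_cast this
      have hF : (m : ℚ) ≤ (fiber col (A (j + 1))).card := by exact_mod_cast hAm _ hj.le
      have h4 : ((N j).card : ℚ) / (fiber col (A (j + 1))).card ≤
          (N j \ Cj (j + 1)).card / m + (Cj (j + 1)).card / (fiber col (A (j + 1))).card := by
        refine (div_le_div_of_nonneg_right h3 (by positivity)).trans ?_
        rw [add_div]
        exact add_le_add_left (div_le_div_of_nonneg_left (Nat.cast_nonneg _) hmQ hF) _
      have h5 : ((N j \ Cj (j + 1)).card : ℚ) / m + (P (j + 1)).card / m ≤ (P j).card / m := by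
        rw [← add_div]
        exact div_le_div_of_nonneg_right (by exact_mod_cast hexit j hj) hmQ.le
      linarith
  obtain ⟨B', hB'⟩ : ∃ F : Finset V, ∀ b, b ∈ F ↔ col b = A 0 ∧ (b ∈ X ∨ ¬ Good b) :=
    ⟨Finset.univ.filter fun b => col b = A 0 ∧ (b ∈ X ∨ ¬ Good b), by simp⟩
  have hXcard : (X.filter C).card + (X.filter fun x => ¬ C x).card = X.card :=
    Finset.card_filter_add_card_filter_not _
  obtain ⟨X', hX'⟩ : ∃ F : Finset V, F = X.filter fun x => ¬ C x := ⟨_, rfl⟩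
  rw [← hX'] at hXcard
  refine ⟨B', fun x hx => (hB' x).2 ⟨hX x hx, Or.inl hx⟩, ?_, ?_⟩
  · intro b hb hbB
    simp only [hB', hb, true_and, not_or, not_not] at hbB
    exact (hGood b).1 hbB.2
  · have h1 := hinv (k - 1) (by omega)
    have h2 := hCN (k - 1) (by omega)
    have hk1 : k - 1 + 1 = k := by omega
    rw [hk1] at h2
    have h3 : (N (k - 1)).card ≤ B.card := by
      refine Finset.card_le_card fun v hv => ?_
      rw [hN, hk1] at hv
      obtain ⟨hv, u, hu, huk, huv⟩ := hv
      exact hClast hu hv (Or.inr ⟨k - 1, by omega, huk, hk1.symm ▸ hv, huv⟩)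
    have h4 : ((N (k - 1)).card : ℚ) / (fiber col (A k)).card ≤
        B.card / (fiber col (A k)).card :=
      div_le_div_of_nonneg_right (by exact_mod_cast h3) (Nat.cast_nonneg _)
    have h5 : B' ⊆ Cj 0 ∪ X' := by
      intro b hb
      rw [hB'] at hb
      rw [hX', Finset.mem_union, hCj, Finset.mem_filter]
      by_cases hbC : C b
      · exact Or.inl ⟨hbC, hb.1⟩
      · right
        refine ⟨?_, hbC⟩
        by_contra hbX
        exact hbC ((hC b).2 ⟨b, hb.1, hbX, hb.2.resolve_left hbX, .refl⟩)
    have h6 : (P 0).card ≤ (X.filter C).card := by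
      refine Finset.card_le_card fun x hx => ?_
      rw [hP] at hx
      refine Finset.mem_filter.2 ⟨?_, hx.1⟩
      rcases Finset.mem_union.1 hx.2.2.1 with h | h
      · exact h
      · obtain ⟨j, hj, hjk, hxj⟩ := mem_inner.1 h
        have := hA 0 (by omega) j hjk.le (hx.2.1.symm.trans hxj)
        omega
    have h8 : ((P 0).card : ℚ) / m + X'.card / m ≤ X.card / m := by
      rw [← add_div]
      have : (P 0).card + X'.card ≤ X.card := by omega
      exact div_le_div_of_nonneg_right (by exact_mod_cast this) hmQ.le
    have h9 : (B'.card : ℚ) ≤ (Cj 0).card + X'.card := by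
      exact_mod_cast (Finset.card_le_card h5).trans (Finset.card_union_le _ _)
    have hF : (m : ℚ) ≤ (fiber col (A 0)).card := by exact_mod_cast hAm 0 (by omega)
    have h10 := (div_le_div_of_nonneg_right h9
      (Nat.cast_nonneg (α := ℚ) (fiber col (A 0)).card))
    rw [add_div] at h10
    have h11 : (X'.card : ℚ) / (fiber col (A 0)).card ≤ X'.card / m :=
      div_le_div_of_nonneg_left (Nat.cast_nonneg _) hmQ hF
    have h12 : (0 : ℚ) ≤ (P (k - 1)).card / m := div_nonneg (Nat.cast_nonneg _) hmQ.le
    linarith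

end Linkage

/-- The vertices in `I` are roots (of color `c`) of pairwise disjoint connected sets with colors in
`U`, each of which meets all color classes in `S`. -/
def Realizes {V ι : Type*} (G : SimpleGraph V) (col : V → ι) (c : ι) (U S : Set ι)
    (I : Finset V) : Prop :=
  ∃ D : V → Set V,
    (∀ x ∈ I, col x = c ∧ x ∈ D x ∧ (∀ y ∈ D x, col y = c → y = x) ∧ (∀ y ∈ D x, col y ∈ U) ∧
      (∀ y ∈ D x, ∃ p : G.Walk x y, ∀ z ∈ p.support, z ∈ D x) ∧ ∀ s ∈ S, ∃ y ∈ D x, col y = s) ∧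
    ∀ x ∈ I, ∀ y ∈ I, x ≠ y → Disjoint (D x) (D y)

section Linkage

variable {V ι : Type*} [Fintype V] {G : SimpleGraph V} {col : V → ι} {A : ℕ → ι} {k : ℕ}
  {X Y : Finset V} {f : V → V}

theorem IsLinkage.col_iterate_and_adj (hf : IsLinkage G col A k X Y f)
    (hA : ∀ i ≤ k, ∀ j ≤ k, A i = A j → i = j) (hX : ∀ x ∈ X, col x = A 0) {x : V} (hx : x ∈ X)
    (j : ℕ) (hj : j < k) :
    f^[j] x ∈ (X : Set V) ∪ inner col A k ∧ col (f^[j] x) = A j ∧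
      col (f^[j + 1] x) = A (j + 1) ∧ G.Adj (f^[j] x) (f^[j + 1] x) := by
  classical
  induction j using Nat.strong_induction_on with
  | _ j ih =>
    have hcol : col (f^[j] x) = A j := by
      rcases Nat.eq_zero_or_pos j with rfl | h
      · exact hX x hx
      · obtain ⟨i, rfl⟩ : ∃ i, j = i + 1 := ⟨j - 1, by omega⟩
        exact (ih i (by omega) (by omega)).2.2.1
    have hmem : f^[j] x ∈ (X : Set V) ∪ inner col A k := by
      rcases Nat.eq_zero_or_pos j with rfl | h
      · exact Or.inl hx
      · exact Or.inr (Finset.mem_coe.2 (mem_inner.2 ⟨j, h, hj, hcol⟩))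
    refine ⟨hmem, hcol, ?_⟩
    have hs := hf.step (f^[j] x) (by simpa using hmem)
    rw [← Function.iterate_succ_apply' f j x] at hs
    rcases hs with ⟨heq, i, hi, hik, hcol'⟩ | ⟨i, hi, h3, h4, h5⟩
    · obtain rfl := hA _ (by omega) _ (by omega) (hcol.symm.trans hcol')
      obtain ⟨l, rfl⟩ : ∃ l, j = l + 1 := ⟨j - 1, by omega⟩
      obtain ⟨h1, h2, -⟩ := ih l (by omega) (by omega)
      have : f^[l] x = f^[l + 1] x := by
        refine hf.injOn (by simpa using h1) (by simpa using hmem) ?_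
        rwa [← Function.iterate_succ_apply' f l x, ← Function.iterate_succ_apply' f (l + 1) x]
      have := hA _ (by omega) _ (by omega) (h2.symm.trans (this ▸ hcol))
      omega
    · obtain rfl := hA _ (by omega) _ (by omega) (hcol.symm.trans h3)
      exact ⟨h4, h5⟩

theorem IsLinkage.realizes (hf : IsLinkage G col A k X Y f) (hk : 0 < k)
    (hA : ∀ i ≤ k, ∀ j ≤ k, A i = A j → i = j) (hX : ∀ x ∈ X, col x = A 0) {U S : Set ι}
    (hAU : ∀ j < k, A j ∉ U) (hY : Realizes G col (A k) U S Y) :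
    Realizes G col (A 0) (U ∪ {i | ∃ j < k, A j = i}) S X := by
  classical
  obtain ⟨D, hD, hDD⟩ := hY
  have hit := fun x hx j hj => hf.col_iterate_and_adj hA hX (x := x) hx j hj
  have hlast : ∀ x ∈ X, f^[k] x ∈ Y := by
    intro x hx
    obtain ⟨l, rfl⟩ : ∃ l, k = l + 1 := ⟨k - 1, by omega⟩
    obtain ⟨h1, -, h2, -⟩ := hit x hx l (by omega)
    have : f^[l + 1] x ∈ inner col A (l + 1) ∪ Y := by
      rw [← hf.image, Function.iterate_succ_apply' f l x]
      exact Finset.mem_image_of_mem f (by simpa using h1)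
    rcases Finset.mem_union.1 this with h | h
    · obtain ⟨j, -, hj, hxj⟩ := mem_inner.1 h
      have := hA _ le_rfl j (by omega) (h2.symm.trans hxj)
      omega
    · exact h
  have hinj : ∀ x ∈ X, ∀ y ∈ X, x ≠ y → ∀ j ≤ k, f^[j] x ≠ f^[j] y := by
    intro x hx y hy hxy j
    induction j with
    | zero => intro _; exact hxy
    | succ j ih =>
      intro hj h
      rw [Function.iterate_succ_apply', Function.iterate_succ_apply'] at h
      exact ih (by omega) (hf.injOn (by simpa using (hit x hx j (by omega)).1)
        (by simpa using (hit y hy j (by omega)).1) h)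
  refine ⟨fun x => {z | ∃ j < k, f^[j] x = z} ∪ D (f^[k] x), fun x hx => ?_, ?_⟩
  · obtain ⟨h1, h2, h3, h4, h5, h6⟩ := hD _ (hlast x hx)
    refine ⟨hX x hx, Or.inl ⟨0, hk, rfl⟩, ?_, ?_, ?_, ?_⟩
    · rintro y (⟨j, hj, rfl⟩ | hy) hc
      · obtain rfl := hA _ (by omega) _ (by omega) ((hit x hx j hj).2.1.symm.trans hc)
        rfl
      · exact absurd (hc ▸ h4 y hy) (hAU 0 hk)
    · rintro y (⟨j, hj, rfl⟩ | hy)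
      · exact Or.inr ⟨j, hj, (hit x hx j hj).2.1.symm⟩
      · exact Or.inl (h4 y hy)
    · have hwalk : ∀ j ≤ k, ∃ p : G.Walk x (f^[j] x),
          ∀ z ∈ p.support, z ∈ {z | ∃ j < k, f^[j] x = z} ∪ D (f^[k] x) := by
        intro j
        induction j with
        | zero => intro _; exact ⟨.nil, by simpa using Or.inl ⟨0, hk, rfl⟩⟩
        | succ j ih =>
          intro hj
          obtain ⟨p, hp⟩ := ih (by omega)
          refine ⟨p.concat (hit x hx j hj).2.2.2, fun z hz => ?_⟩
          rw [SimpleGraph.Walk.support_concat, List.mem_append,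
            List.mem_singleton] at hz
          rcases hz with hz | rfl
          · exact hp z hz
          · rcases Nat.lt_or_ge (j + 1) k with h | h
            · exact Or.inl ⟨j + 1, h, rfl⟩
            · obtain rfl : j + 1 = k := by omega
              exact Or.inr h2
      rintro y (⟨j, hj, rfl⟩ | hy)
      · exact hwalk j hj.le
      · obtain ⟨p, hp⟩ := hwalk k le_rfl
        obtain ⟨q, hq⟩ := h5 y hy
        refine ⟨p.append q, fun z hz => ?_⟩
        rcases SimpleGraph.Walk.mem_support_append_iff .. |>.1 hz with h | h
        · exact hp z h
        · exact Or.inr (hq z h)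
    · intro s hs
      obtain ⟨y, hy, hys⟩ := h6 s hs
      exact ⟨y, Or.inr hy, hys⟩
  · intro x hx y hy hxy
    rw [Set.disjoint_left]
    rintro z (⟨i, hi, rfl⟩ | hz) (⟨j, hj, hzj⟩ | hz')
    · obtain rfl := hA _ (by omega) _ (by omega)
        ((hit x hx i hi).2.1.symm.trans (hzj ▸ (hit y hy j hj).2.1))
      exact hinj x hx y hy hxy i hi.le hzj.symm
    · exact hAU i hi ((hit x hx i hi).2.1 ▸ (hD _ (hlast y hy)).2.2.2.1 _ hz')
    · subst hzj
      exact hAU j hj ((hit y hy j hj).2.1 ▸ (hD _ (hlast x hx)).2.2.2.1 _ hz)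
    · exact Set.disjoint_left.1
        (hDD _ (hlast x hx) _ (hlast y hy) (hinj x hx y hy hxy k le_rfl)) hz hz'

end Linkage

open scoped Classical in
/-- There is a family of sets of roots, all of which are realized, such that all but few vertices of
color `c` can be added to any given member of the family. -/
def Extendable {V ι : Type*} [Fintype V] (G : SimpleGraph V) (col : V → ι) (m : ℕ) (c : ι)
    (U S : Set ι) (n : ℕ) : Prop :=
  ∃ F : Finset V → Prop, F ∅ ∧ (∀ I, F I → Realizes G col c U S I) ∧
    ∀ I, F I → ∃ B, I ⊆ B ∧ (∀ b, col b = c → b ∉ B → F (insert b I)) ∧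
      (B.card : ℚ) / (fiber col c).card ≤ n * (I.card / m)

/-- Trees of color classes rooted at `c`, with color classes `U`, among them the terminals `S`, all
of them contained in `R`, together with a weight `n` bounding the number of pieces. The Boolean
indicates whether the part at the root is a path that can be extended at no cost. -/
inductive ClassTree {V ι : Type*} (G : SimpleGraph V) (col : V → ι) (R : Set ι) :
    Bool → ι → Set ι → Set ι → ℕ → Prop
  | leaf (c : ι) (hc : c ∈ R) : ClassTree G col R false c {c} {c} 1
  | join {c : ι} {U S U' S' : Set ι} {n n' : ℕ} (hT : ClassTree G col R false c U S n)
      (hT' : ClassTree G col R false c U' S' n') (hU : U ∩ U' ⊆ {c}) :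
      ClassTree G col R false c (U ∪ U') (S ∪ S') (n + n')
  | beginPath {c : ι} {U S : Set ι} {n : ℕ} (hT : ClassTree G col R false c U S n) :
      ClassTree G col R true c U S (n + 1)
  | extendPath {c c' : ι} {U S : Set ι} {n : ℕ} (hT : ClassTree G col R true c U S n)
      (hc' : c' ∈ R) (hU : c' ∉ U) (hadj : ColorAdj G col c' c) :
      ClassTree G col R true c' (insert c' U) S n
  | endPath {c : ι} {U S : Set ι} {n : ℕ} (hT : ClassTree G col R true c U S n) :
      ClassTree G col R false c U S n

section ClassTree

variable {V ι : Type*} {G : SimpleGraph V} {col : V → ι} {R : Set ι}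

theorem Extendable.path [Fintype V] (hG : Equitable G col) {m : ℕ} (hm : 0 < m) {A : ℕ → ι} {k : ℕ}
    (hk : 0 < k) (hA : ∀ i ≤ k, ∀ j ≤ k, A i = A j → i = j)
    (hadj : ∀ j < k, ColorAdj G col (A j) (A (j + 1)))
    (hAm : ∀ j ≤ k, m ≤ (fiber col (A j)).card) {U S : Set ι} (hAU : ∀ j < k, A j ∉ U) {n : ℕ}
    (h : Extendable G col m (A k) U S n) :
    Extendable G col m (A 0) (U ∪ {i | ∃ j < k, A j = i}) S (n + 1) := by
  classical
  obtain ⟨F, h0, hreal, hext⟩ := h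
  refine ⟨fun X => (∀ x ∈ X, col x = A 0) ∧ ∃ Y, F Y ∧ ∃ f, IsLinkage G col A k X Y f,
    ⟨by simp, ∅, h0, id, ?_, ?_, ?_⟩, ?_, ?_⟩
  · exact Function.injective_id.injOn
  · intro x hx
    exact Or.inl ⟨rfl, by simpa using hx⟩
  · simp
  · rintro X ⟨hX, Y, hY, f, hf⟩
    exact hf.realizes hk hA hX hAU (hreal Y hY)
  · rintro X ⟨hX, Y, hY, f, hf⟩
    obtain ⟨B, hYB, hB, hcard⟩ := hext Y hY
    obtain ⟨B', hXB', hB', hcard'⟩ := hf.exists_augment hG hk hA hadj hm hAm hX hYB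
    have hYcol : ∀ y ∈ Y, col y = A k := by
      obtain ⟨D, hD, -⟩ := hreal Y hY
      exact fun y hy => (hD y hy).1
    refine ⟨B', hXB', ?_, ?_⟩
    · intro b hb hbB
      obtain ⟨r, hr, hrB, g, hg⟩ := hB' b hb hbB
      refine ⟨?_, insert r Y, ?_, g, ?_⟩
      · intro x hx
        rcases Finset.mem_insert.1 hx with rfl | hx
        · exact hb
        · exact hX x hx
      · convert hB r hr hrB
      · convert hg
    · rw [← hf.card_eq hA hX hYcol] at hcard
      push_cast
      linarith

theorem Extendable.join [Fintype V] {m : ℕ} {c : ι} {U S U' S' : Set ι} {n n' : ℕ}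
    (hU : U ∩ U' ⊆ {c}) (h : Extendable G col m c U S n) (h' : Extendable G col m c U' S' n') :
    Extendable G col m c (U ∪ U') (S ∪ S') (n + n') := by
  classical
  obtain ⟨F, h0, hreal, hext⟩ := h
  obtain ⟨F', h0', hreal', hext'⟩ := h'
  refine ⟨fun I => F I ∧ F' I, ⟨h0, h0'⟩, ?_, ?_⟩
  · rintro I ⟨hI, hI'⟩
    obtain ⟨D, hD, hDD⟩ := hreal I hI
    obtain ⟨D', hD', hDD'⟩ := hreal' I hI'
    have hcross : ∀ x ∈ I, ∀ y ∈ I, x ≠ y → Disjoint (D x) (D' y) := by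
      intro x hx y hy hxy
      rw [Set.disjoint_left]
      intro z hz hz'
      obtain ⟨-, -, h3, h4, -⟩ := hD x hx
      obtain ⟨-, -, h3', h4', -⟩ := hD' y hy
      have hzc : col z = c := hU ⟨h4 z hz, h4' z hz'⟩
      exact hxy ((h3 z hz hzc).symm.trans (h3' z hz' hzc))
    refine ⟨fun x => D x ∪ D' x, fun x hx => ?_, fun x hx y hy hxy => ?_⟩
    · obtain ⟨h1, h2, h3, h4, h5, h6⟩ := hD x hx
      obtain ⟨-, -, h3', h4', h5', h6'⟩ := hD' x hx
      refine ⟨h1, Or.inl h2, ?_, ?_, ?_, ?_⟩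
      · rintro y (hy | hy)
        · exact h3 y hy
        · exact h3' y hy
      · rintro y (hy | hy)
        · exact Or.inl (h4 y hy)
        · exact Or.inr (h4' y hy)
      · rintro y (hy | hy)
        · obtain ⟨p, hp⟩ := h5 y hy
          exact ⟨p, fun z hz => Or.inl (hp z hz)⟩
        · obtain ⟨p, hp⟩ := h5' y hy
          exact ⟨p, fun z hz => Or.inr (hp z hz)⟩
      · rintro s (hs | hs)
        · obtain ⟨y, hy, hys⟩ := h6 s hs
          exact ⟨y, Or.inl hy, hys⟩
        · obtain ⟨y, hy, hys⟩ := h6' s hs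
          exact ⟨y, Or.inr hy, hys⟩
    · rw [Set.disjoint_union_left, Set.disjoint_union_right, Set.disjoint_union_right]
      exact ⟨⟨hDD x hx y hy hxy, hcross x hx y hy hxy⟩,
        (hcross y hy x hx hxy.symm).symm, hDD' x hx y hy hxy⟩
  · rintro I ⟨hI, hI'⟩
    obtain ⟨B, h1, h2, h3⟩ := hext I hI
    obtain ⟨B', h1', h2', h3'⟩ := hext' I hI'
    refine ⟨B ∪ B', h1.trans Finset.subset_union_left, fun b hb hbB => ?_, ?_⟩
    · rw [Finset.mem_union, not_or] at hbB
      constructor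
      · convert h2 b hb hbB.1
      · convert h2' b hb hbB.2
    · have h4 : ((B ∪ B').card : ℚ) ≤ B.card + B'.card := by
        exact_mod_cast Finset.card_union_le _ _
      have h5 := div_le_div_of_nonneg_right h4 (Nat.cast_nonneg (α := ℚ) (fiber col c).card)
      rw [add_div] at h5
      push_cast
      linarith

theorem Extendable.leaf [Fintype V] {m : ℕ} (hm : 0 < m) {c : ι} (hc : m ≤ (fiber col c).card) :
    Extendable G col m c {c} {c} 1 := by
  classical
  refine ⟨fun I => ∀ x ∈ I, col x = c, by simp, fun I hI => ?_, fun I hI => ⟨I, subset_rfl, ?_, ?_⟩⟩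
  · refine ⟨fun x => {x}, fun x hx => ⟨hI x hx, rfl, fun y hy _ => hy, ?_, ?_, ?_⟩, ?_⟩
    · rintro y rfl
      exact hI y hx
    · rintro y rfl
      exact ⟨.nil, by simp⟩
    · rintro s rfl
      exact ⟨x, rfl, hI x hx⟩
    · intro x _ y _ hxy
      simpa using hxy
  · intro b hb _ x hx
    rcases Finset.mem_insert.1 hx with rfl | hx
    · exact hb
    · exact hI x hx
  · rw [Nat.cast_one, one_mul]
    exact div_le_div_of_nonneg_left (Nat.cast_nonneg _) (by exact_mod_cast hm)
      (by exact_mod_cast hc)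

theorem Extendable.mono [Fintype V] {m : ℕ} {c : ι} {U S : Set ι} {n n' : ℕ} (hn : n ≤ n')
    (h : Extendable G col m c U S n) : Extendable G col m c U S n' := by
  obtain ⟨F, h0, hreal, hext⟩ := h
  refine ⟨F, h0, hreal, fun I hI => ?_⟩
  obtain ⟨B, h1, h2, h3⟩ := hext I hI
  refine ⟨B, h1, h2, h3.trans ?_⟩
  exact mul_le_mul_of_nonneg_right (by exact_mod_cast hn)
    (div_nonneg (Nat.cast_nonneg _) (Nat.cast_nonneg _))

theorem ClassTree.root_mem {b : Bool} {c : ι} {U S : Set ι} {n : ℕ}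
    (h : ClassTree G col R b c U S n) : c ∈ U := by
  induction h with
  | leaf c hc => rfl
  | join _ _ _ ih _ => exact Or.inl ih
  | beginPath _ ih => exact ih
  | extendPath => exact Or.inl rfl
  | endPath _ ih => exact ih

theorem ClassTree.subset {b : Bool} {c : ι} {U S : Set ι} {n : ℕ}
    (h : ClassTree G col R b c U S n) : U ⊆ R := by
  induction h with
  | leaf c hc => simpa using hc
  | join _ _ _ ih ih' => exact Set.union_subset ih ih'
  | beginPath _ ih => exact ih
  | extendPath _ hc _ _ ih => exact Set.insert_subset hc ih
  | endPath _ ih => exact ih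

theorem ClassTree.extendable_aux [Fintype V] (hG : Equitable G col) {m : ℕ} (hm : 0 < m)
    (hR : ∀ c ∈ R, m ≤ (fiber col c).card) {b : Bool} {c : ι} {U S : Set ι} {n : ℕ}
    (h : ClassTree G col R b c U S n) :
    (b = false → Extendable G col m c U S n) ∧
    (b = true → ∃ (k : ℕ) (A : ℕ → ι) (U' : Set ι) (n' : ℕ), A 0 = c ∧
      (∀ i ≤ k, ∀ j ≤ k, A i = A j → i = j) ∧ (∀ j < k, ColorAdj G col (A j) (A (j + 1))) ∧
      (∀ j ≤ k, A j ∈ R) ∧ (∀ j < k, A j ∉ U') ∧ A k ∈ U' ∧ U = U' ∪ {i | ∃ j < k, A j = i} ∧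
      n = n' + 1 ∧ Extendable G col m (A k) U' S n') := by
  induction h with
  | leaf c hc => exact ⟨fun _ => .leaf hm (hR c hc), by simp⟩
  | join _ _ hU ih ih' => exact ⟨fun _ => .join hU (ih.1 rfl) (ih'.1 rfl), by simp⟩
  | @beginPath c U S n hT ih =>
    refine ⟨by simp, fun _ => ⟨0, fun _ => c, U, n, rfl, ?_, by simp, ?_, by simp, hT.root_mem,
      by simp, rfl, ih.1 rfl⟩⟩
    · omega
    · exact fun _ _ => hT.subset hT.root_mem
  | @extendPath c c' U S n hT hc' hU hadj ih =>
    refine ⟨by simp, fun _ => ?_⟩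
    obtain ⟨k, A, U', n', rfl, hA, hAadj, hAR, hAU, hAk, rfl, hn, hext⟩ := ih.2 rfl
    have hne : ∀ j ≤ k, c' ≠ A j := by
      rintro j hj rfl
      rcases hj.lt_or_eq with h | rfl
      · exact hU (Or.inr ⟨j, h, rfl⟩)
      · exact hU (Or.inl hAk)
    refine ⟨k + 1, fun j => Nat.casesOn j c' A, U', n', rfl, ?_, ?_, ?_, ?_, hAk, ?_, hn, hext⟩
    · rintro (_ | i) hi (_ | j) hj h
      · rfl
      · exact absurd h (hne j (by omega))
      · exact absurd h.symm (hne i (by omega))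
      · exact congrArg _ (hA i (by omega) j (by omega) h)
    · rintro (_ | j) hj
      · exact hadj
      · exact hAadj j (by omega)
    · rintro (_ | j) hj
      · exact hc'
      · exact hAR j (by omega)
    · rintro (_ | j) hj
      · exact fun h => hU (Or.inl h)
      · exact hAU j (by omega)
    · ext i
      simp only [Set.mem_insert_iff, Set.mem_union, Set.mem_ofPred_eq]
      constructor
      · rintro (rfl | h | ⟨j, hj, rfl⟩)
        · exact Or.inr ⟨0, by omega, rfl⟩
        · exact Or.inl h
        · exact Or.inr ⟨j + 1, by omega, rfl⟩
      · rintro (h | ⟨_ | j, hj, rfl⟩)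
        · exact Or.inr (Or.inl h)
        · exact Or.inl rfl
        · exact Or.inr (Or.inr ⟨j, by omega, rfl⟩)
  | @endPath c U S n hT ih =>
    refine ⟨fun _ => ?_, by simp⟩
    obtain ⟨k, A, U', n', rfl, hA, hAadj, hAR, hAU, hAk, rfl, rfl, hext⟩ := ih.2 rfl
    rcases Nat.eq_zero_or_pos k with rfl | hk
    · simpa using hext.mono (Nat.le_succ n')
    · exact hext.path hG hm hk hA hAadj (fun j hj => hR _ (hAR j hj)) hAU

theorem ClassTree.extendable [Fintype V] (hG : Equitable G col) {m : ℕ} (hm : 0 < m)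
    (hR : ∀ c ∈ R, m ≤ (fiber col c).card) {c : ι} {U S : Set ι} {n : ℕ}
    (h : ClassTree G col R false c U S n) : Extendable G col m c U S n :=
  (h.extendable_aux hG hm hR).1 rfl

/-- A tree of color classes can be enlarged by a path to a new terminal `d`. -/
theorem ClassTree.attach {b : Bool} {c B d : ι} {U S W : Set ι} {n : ℕ}
    (h : ClassTree G col R b c U S n) (hB : B ∈ U) (hW : ClassTree G col R false B W {d} 2)
    (hUW : U ∩ W ⊆ {B}) : ∃ n' ≤ n + 3, ClassTree G col R b c (U ∪ W) (S ∪ {d}) n' := by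
  induction h with
  | leaf c hc =>
    obtain rfl : B = c := hB
    exact ⟨1 + 2, by omega, .join (.leaf B hc) hW hUW⟩
  | @join c U S U' S' n n' hT hT' hU ih ih' =>
    rcases hB with hB | hB
    · obtain ⟨l, hl, h⟩ := ih hB fun x hx => hUW ⟨Or.inl hx.1, hx.2⟩
      refine ⟨l + n', by omega, ?_⟩
      rw [Set.union_right_comm, Set.union_right_comm S]
      refine .join h hT' ?_
      rintro x ⟨hx | hx, hx'⟩
      · exact hU ⟨hx, hx'⟩
      · obtain rfl : x = B := hUW ⟨Or.inr hx', hx⟩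
        exact hU ⟨hB, hx'⟩
    · obtain ⟨l, hl, h⟩ := ih' hB fun x hx => hUW ⟨Or.inr hx.1, hx.2⟩
      refine ⟨n + l, by omega, ?_⟩
      rw [Set.union_assoc, Set.union_assoc S]
      refine .join hT h ?_
      rintro x ⟨hx, hx' | hx'⟩
      · exact hU ⟨hx, hx'⟩
      · obtain rfl : x = B := hUW ⟨Or.inl hx, hx'⟩
        exact hU ⟨hx, hB⟩
  | beginPath _ ih =>
    obtain ⟨l, hl, h⟩ := ih hB hUW
    exact ⟨l + 1, by omega, .beginPath h⟩
  | @extendPath c c' U S n hT hc' hU hadj ih =>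
    by_cases hBc : B = c'
    · subst hBc
      exact ⟨n + 2 + 1, by omega, .beginPath (.join (.endPath (.extendPath hT hc' hU hadj)) hW hUW)⟩
    · obtain ⟨l, hl, h⟩ := ih (hB.resolve_left hBc) fun x hx => hUW ⟨Or.inr hx.1, hx.2⟩
      refine ⟨l, hl, ?_⟩
      rw [Set.insert_union]
      refine .extendPath h hc' ?_ hadj
      rintro (h | h)
      · exact hU h
      · exact hBc (hUW ⟨Or.inl rfl, h⟩).symm
  | endPath _ ih =>
    obtain ⟨l, hl, h⟩ := ih hB hUW
    exact ⟨l, hl, .endPath h⟩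

/-- `W` is the set of color classes on a path from `c` to `d`. -/
inductive ClassPath (G : SimpleGraph V) (col : V → ι) (R : Set ι) (d : ι) : ι → Set ι → Prop
  | nil (hd : d ∈ R) : ClassPath G col R d d {d}
  | cons {c c' : ι} {W : Set ι} (hP : ClassPath G col R d c W) (hc' : c' ∈ R) (hW : c' ∉ W)
      (hadj : ColorAdj G col c' c) : ClassPath G col R d c' (insert c' W)

theorem ClassPath.classTree {d c : ι} {W : Set ι} (h : ClassPath G col R d c W) :
    ClassTree G col R true c W {d} 2 := by
  induction h with
  | nil hd => exact .beginPath (.leaf d hd)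
  | cons _ hc' hW hadj ih => exact .extendPath ih hc' hW hadj

theorem ClassPath.exists_last {d c : ι} {W : Set ι} (h : ClassPath G col R d c W) {U : Set ι}
    (hU : (U ∩ W).Nonempty) : ∃ B ∈ U, ∃ W', ClassPath G col R d B W' ∧ U ∩ W' ⊆ {B} := by
  induction h with
  | nil hd =>
    obtain ⟨B, hB, rfl⟩ := hU
    exact ⟨B, hB, {B}, .nil hd, Set.inter_subset_right⟩
  | @cons c c' W hP hc' hW hadj ih =>
    by_cases h : (U ∩ W).Nonempty
    · exact ih h
    · obtain ⟨B, hB, rfl | hBW⟩ := hU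
      · refine ⟨B, hB, insert B W, .cons hP hc' hW hadj, ?_⟩
        rintro x ⟨hx, rfl | hx'⟩
        · rfl
        · exact absurd ⟨x, hx, hx'⟩ h
      · exact absurd ⟨B, hB, hBW⟩ h

theorem ClassPath.exists_of_walk {u v : V} (p : G.Walk u v) (hp : ∀ x ∈ p.support, col x ∈ R) :
    ∃ W, ClassPath G col R (col v) (col u) W := by
  induction p with
  | nil => exact ⟨_, .nil (hp _ (by simp))⟩
  | @cons u u' v huu' p ih =>
    obtain ⟨W, hW⟩ := ih fun x hx => hp x (by simp [hx])
    by_cases hu : col u ∈ W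
    · obtain ⟨B, rfl, W', hW', -⟩ := hW.exists_last (U := {col u}) ⟨_, rfl, hu⟩
      exact ⟨W', hW'⟩
    · exact ⟨_, .cons hW (hp u (by simp)) hu ⟨u, u', huu', rfl, rfl⟩⟩

theorem ClassPath.root_mem {d c : ι} {W : Set ι} (h : ClassPath G col R d c W) : c ∈ W := by
  cases h with
  | nil => rfl
  | cons => exact Or.inl rfl

/-- Any `k + 1` vertices of a connected set `Z` have their color classes joined by a tree. -/
theorem ClassTree.exists_of_connected {Z : Set V}
    (hZ : ∀ x ∈ Z, ∀ y ∈ Z, ∃ p : G.Walk x y, ∀ u ∈ p.support, u ∈ Z) (k : ℕ) (z : ℕ → V)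
    (hz : ∀ i ≤ k, z i ∈ Z) :
    ∃ c U S n, ClassTree G col (col '' Z) false c U S n ∧ (∀ i ≤ k, col (z i) ∈ S) ∧
      col (z 0) ∈ U ∧ n ≤ 3 * k + 1 := by
  induction k with
  | zero =>
    exact ⟨col (z 0), {col (z 0)}, {col (z 0)}, 1, .leaf _ ⟨z 0, hz 0 le_rfl, rfl⟩,
      by simp, rfl, by omega⟩
  | succ k ih =>
    obtain ⟨c, U, S, n, hT, hS, h0, hn⟩ := ih fun i hi => hz i (by omega)
    obtain ⟨p, hp⟩ := hZ (z 0) (hz 0 (by omega)) (z (k + 1)) (hz _ le_rfl)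
    obtain ⟨W, hW⟩ := ClassPath.exists_of_walk (R := col '' Z) p fun x hx => ⟨x, hp x hx, rfl⟩
    obtain ⟨B, hB, W', hW', hUW⟩ := hW.exists_last (U := U) ⟨_, h0, hW.root_mem⟩
    obtain ⟨n', hn', hT'⟩ := hT.attach hB (.endPath hW'.classTree) hUW
    refine ⟨c, _, _, n', hT', fun i hi => ?_, Or.inl h0, by omega⟩
    rcases Nat.le_succ_iff.1 hi with h | rfl
    · exact Or.inl (hS i h)
    · exact Or.inr rfl

/-- Sets of roots with room for more vertices can be extended greedily. -/
theorem Extendable.exists_realizes [Fintype V] {m : ℕ} {c : ι} {U S : Set ι} {n q : ℕ}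
    (h : Extendable G col m c U S n) (hq : n * q < m) (hc : m ≤ (fiber col c).card) :
    ∃ I : Finset V, I.card = q + 1 ∧ Realizes G col c U S I := by
  classical
  obtain ⟨F, h0, hreal, hext⟩ := h
  suffices ∀ l ≤ q + 1, ∃ I : Finset V, I.card = l ∧ F I by
    obtain ⟨I, hI, hF⟩ := this _ le_rfl
    exact ⟨I, hI, hreal I hF⟩
  intro l
  induction l with
  | zero => intro _; exact ⟨∅, rfl, h0⟩
  | succ l ih =>
    intro hl
    obtain ⟨I, rfl, hI⟩ := ih (by omega)
    obtain ⟨B, hIB, hB, hcard⟩ := hext I hI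
    have hm : 0 < m := by omega
    have hlt : B.card < (fiber col c).card := by
      have hf : (0 : ℚ) < (fiber col c).card := by exact_mod_cast hm.trans_le hc
      have h1 : (n : ℚ) * (I.card / m) < 1 := by
        rw [← mul_div_assoc, div_lt_one (by exact_mod_cast hm)]
        have : n * I.card ≤ n * q := Nat.mul_le_mul_left n (by omega)
        exact_mod_cast this.trans_lt hq
      exact_mod_cast (div_lt_one hf).1 (hcard.trans_lt h1)
    obtain ⟨b, hb, hbB⟩ := Finset.exists_mem_notMem_of_card_lt_card hlt
    refine ⟨insert b I, Finset.card_insert_of_notMem fun h => hbB (hIB h), ?_⟩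
    convert hB b (mem_fiber.1 hb) hbB

end ClassTree

/-- Branch vertices that are pairwise joined through pairwise disjoint sets avoiding all branch
vertices span a topological complete graph. -/
theorem hasTopologicalSubgraph_top {V W : Type*} {G : SimpleGraph V} {f : W → V}
    (hf : Function.Injective f) (D : W × W → Set V) (hfD : ∀ e w, f w ∉ D e)
    (hD : ∀ e e', e ≠ e' → Disjoint (D e) (D e'))
    (hwalk : ∀ u v, ∃ p : G.Walk (f u) (f v), ∀ x ∈ p.support, x = f u ∨ x = f v ∨ x ∈ D (u, v)) :
    HasTopologicalSubgraph G (⊤ : SimpleGraph W) := by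
  classical
  have hpath : ∀ u v, ∃ p : G.Walk (f u) (f v), p.IsPath ∧
      ∀ x ∈ p.support, x = f u ∨ x = f v ∨ x ∈ D (u, v) := by
    intro u v
    obtain ⟨p, hp⟩ := hwalk u v
    exact ⟨p.bypass, p.bypass_isPath, fun x hx => hp x (p.support_bypass_subset_support hx)⟩
  choose P hP hPD using hpath
  have hends : ∀ u v u' v', (s(u, v) : Sym2 W) ≠ s(u', v') → ∀ x ∈ (P u v).support,
      x ∈ (P u' v').support → x = f u ∨ x = f v := by
    intro u v u' v' hne x hx hx'
    rcases hPD u v x hx with h | h | h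
    · exact Or.inl h
    · exact Or.inr h
    · rcases hPD u' v' x hx' with rfl | rfl | h'
      · exact absurd h (hfD _ _)
      · exact absurd h (hfD _ _)
      · refine absurd h' (Set.disjoint_left.1 (hD (u, v) (u', v') ?_) h)
        rintro ⟨⟩
        exact hne rfl
  refine ⟨f, hf, fun u v _ => P u v, fun u v _ => hP u v, fun u v _ w hw => ?_,
    fun u v _ u' v' _ hne x hx hx' => ⟨hends u v u' v' hne x hx hx',
      hends u' v' u v hne.symm x hx' hx⟩⟩
  rcases hPD u v _ hw with h | h | h
  · exact Or.inl (hf h)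
  · exact Or.inr (hf h)
  · exact absurd h (hfD _ _)

/-- If `h` singleton color classes have neighbors in a connected set all of whose color classes are
large, then the graph contains `K_h` as a topological subgraph. -/
theorem Equitable.hasTopologicalSubgraph {V ι : Type*} [Fintype V] {G : SimpleGraph V}
    {col : V → ι} (hG : Equitable G col) {h t : ℕ} (hh : 0 < h) (ht : 3 * h ^ 3 ≤ t) {Z : Set V}
    (hZ : ∀ x ∈ Z, ∀ y ∈ Z, ∃ p : G.Walk x y, ∀ u ∈ p.support, u ∈ Z)
    (hlarge : ∀ z ∈ Z, t < (fiber col (col z)).card) {f : Fin h → V} (hf : Function.Injective f)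
    (hsingle : ∀ i w, col w = col (f i) → w = f i) (hadj : ∀ i, ∃ z ∈ Z, G.Adj (f i) z) :
    HasTopologicalSubgraph G (⊤ : SimpleGraph (Fin h)) := by
  choose z hz hfz using hadj
  obtain ⟨c, U, S, n, hT, hS, -, hn⟩ := ClassTree.exists_of_connected (col := col) hZ (h - 1)
    (fun i => if hi : i < h then z ⟨i, hi⟩ else z ⟨0, hh⟩) (fun i hi => by
      simp only [show i < h by omega, dite_true, hz])
  have hS : ∀ i, col (z i) ∈ S := by
    intro i
    simpa using hS i (by omega)
  have hR : ∀ c ∈ col '' Z, t + 1 ≤ (fiber col c).card := by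
    rintro _ ⟨x, hx, rfl⟩
    exact hlarge x hx
  have hq : n * (h * h - 1) < t + 1 := by
    calc n * (h * h - 1) ≤ (3 * h) * (h * h) := Nat.mul_le_mul (by omega) (Nat.sub_le _ _)
      _ = 3 * h ^ 3 := by ring
      _ < t + 1 := by omega
  obtain ⟨I, hI, D, hD, hDD⟩ := (hT.extendable hG (Nat.succ_pos t) hR).exists_realizes hq
    (hR c (hT.subset hT.root_mem))
  have hhh : 0 < h * h := Nat.mul_pos hh hh
  let e : Fin h × Fin h ≃ I :=
    finProdFinEquiv.trans (I.equivFinOfCardEq (show I.card = h * h by omega)).symm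
  have htpos : 0 < t := lt_of_lt_of_le (by positivity) ht
  refine hasTopologicalSubgraph_top hf (fun p => D (e p)) (fun p w hw => ?_) (fun p q hpq => ?_)
    fun i j => ?_
  · have hlt := hR _ (hT.subset ((hD _ (e p).2).2.2.2.1 _ hw))
    have : (fiber col (col (f w))).card ≤ 1 := by
      refine Finset.card_le_one.2 fun a ha b hb => ?_
      rw [hsingle w a (mem_fiber.1 ha), hsingle w b (mem_fiber.1 hb)]
    omega
  · exact hDD _ (e p).2 _ (e q).2 fun h => hpq (e.injective (Subtype.ext h))
  · obtain ⟨-, -, -, -, hwalk, hmeet⟩ := hD _ (e (i, j)).2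
    have hreach : ∀ l, ∃ y, G.Adj (f l) y ∧
        ∃ p : G.Walk (e (i, j) : V) y, ∀ x ∈ p.support, x ∈ D (e (i, j)) := by
      intro l
      obtain ⟨y, hy, hyl⟩ := hmeet _ (hS l)
      refine ⟨y, ?_, hwalk y hy⟩
      have hpos : 0 < {u | G.Adj (z l) u ∧ col u = col (f l)}.ncard :=
        (Set.ncard_pos (Set.toFinite _)).2 ⟨f l, (hfz l).symm, rfl⟩
      rw [← hG y (z l) hyl] at hpos
      obtain ⟨u, huy, hu⟩ := (Set.ncard_pos (Set.toFinite _)).1 hpos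
      rw [← hsingle l u hu]
      exact huy.symm
    obtain ⟨y, hiy, p, hp⟩ := hreach i
    obtain ⟨y', hjy', p', hp'⟩ := hreach j
    refine ⟨.cons hiy ((p.reverse.append p').concat hjy'.symm), fun x hx => ?_⟩
    rw [SimpleGraph.Walk.support_cons, List.mem_cons, SimpleGraph.Walk.support_concat,
      List.mem_append, List.mem_singleton, SimpleGraph.Walk.mem_support_append_iff,
      SimpleGraph.Walk.support_reverse, List.mem_reverse] at hx
    rcases hx with h | (h | h) | h
    · exact Or.inl h
    · exact Or.inr (Or.inr (hp x h))
    · exact Or.inr (Or.inr (hp' x h))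
    · exact Or.inr (Or.inl h)

theorem exists_walk_of_connectedComponent {V : Type*} {G : SimpleGraph V} {s : Set V}
    (comp : (G.induce s).ConnectedComponent) {x y : V} (hx : x ∈ Subtype.val '' comp.supp)
    (hy : y ∈ Subtype.val '' comp.supp) :
    ∃ p : G.Walk x y, ∀ u ∈ p.support, u ∈ Subtype.val '' comp.supp := by
  classical
  obtain ⟨x, hx, rfl⟩ := hx
  obtain ⟨y, hy, rfl⟩ := hy
  rw [SimpleGraph.ConnectedComponent.mem_supp_iff] at hx hy
  obtain ⟨p⟩ := SimpleGraph.ConnectedComponent.exact (hx.trans hy.symm)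
  let φ : G.induce s →g G := ⟨Subtype.val, fun h => h⟩
  refine ⟨p.map φ, fun u hu => ?_⟩
  replace hu : u ∈ (p.map φ).support := hu
  rw [SimpleGraph.Walk.support_map, List.mem_map] at hu
  obtain ⟨w, hw, rfl⟩ := hu
  refine ⟨w, ?_, rfl⟩
  rw [SimpleGraph.ConnectedComponent.mem_supp_iff, ← hx]
  exact SimpleGraph.ConnectedComponent.sound ⟨(p.takeUntil w hw).reverse⟩

theorem mem_of_adj_connectedComponent {V : Type*} {G : SimpleGraph V} {s : Set V}
    (comp : (G.induce s).ConnectedComponent) {u z : V} (hz : z ∈ Subtype.val '' comp.supp)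
    (hu : u ∈ s) (huz : G.Adj u z) : u ∈ Subtype.val '' comp.supp := by
  obtain ⟨z, hz, rfl⟩ := hz
  refine ⟨⟨u, hu⟩, ?_, rfl⟩
  rw [SimpleGraph.ConnectedComponent.mem_supp_iff] at hz ⊢
  rw [← hz]
  exact SimpleGraph.ConnectedComponent.sound
    (SimpleGraph.Adj.reachable (show (G.induce s).Adj ⟨u, hu⟩ z from huz))

end ColorTree

/-- Let `t ≥ 3h³` and let `G` be a finite graph excluding the complete
graph `K_h` as a topological subgraph. Let `X ⊆ V(G)` and let `Z` be the vertex set of a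
connected component of `G - cl_t^G(X)` (the closure computed in the uncolored graph,
starting from the coloring individualizing all vertices of `X`). Then `|N_G(Z)| < h`. -/
theorem neighborhood_of_component_outside_closure_small
    (V : Type) [Fintype V] (h t : ℕ) (ht : 3 * h ^ 3 ≤ t)
    (G : SimpleGraph V)
    (hex : ¬ HasTopologicalSubgraph G (⊤ : SimpleGraph (Fin h)))
    (X Z : Set V)
    (hZ : ∃ comp : (G.induce (tClosure G (fun _ => ()) (fun _ _ => ()) t X)ᶜ).ConnectedComponent,
      Z = Subtype.val '' comp.supp) :
    {u | u ∉ Z ∧ ∃ z ∈ Z, G.Adj u z}.ncard < h := by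
  classical
  by_contra hcon
  rw [not_lt] at hcon
  obtain ⟨comp, rfl⟩ := hZ
  rcases Nat.eq_zero_or_pos h with rfl | hh
  · exact hex ⟨fun i => i.elim0, fun i => i.elim0, fun i => i.elim0, fun i => i.elim0,
      fun i => i.elim0, fun i => i.elim0⟩
  let N := {u | u ∉ Subtype.val '' comp.supp ∧ ∃ z ∈ Subtype.val '' comp.supp, G.Adj u z}
  obtain ⟨f⟩ : Nonempty (Fin h ↪ N) := by
    refine Function.Embedding.nonempty_of_card_le ?_
    rwa [Fintype.card_fin, ← Nat.card_eq_fintype_card, Nat.card_coe_set_eq]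
  have hfD : ∀ i, (f i : V) ∈ tClosure G (fun _ => ()) (fun _ _ => ()) t X := by
    intro i
    obtain ⟨hi, z, hz, hiz⟩ := (f i).2
    by_contra hiD
    exact hi (ColorTree.mem_of_adj_connectedComponent comp hz hiD hiz)
  obtain ⟨r, ⟨hequiv, hstable, hdisc, hinit, hcoarse⟩, -⟩ := hfD ⟨0, hh⟩
  have hDsingle : ∀ x ∈ tClosure G (fun _ => ()) (fun _ _ => ()) t X, ∀ w, r x w → w = x := by
    rintro x ⟨r', ⟨-, -, -, -, hcoarse'⟩, hx⟩ w hw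
    exact hx w (hcoarse' r hequiv hstable hdisc hinit x w hw)
  let s : Setoid V := ⟨r, hequiv⟩
  have hcol : ∀ x y : V, (Quotient.mk s x = Quotient.mk s y) ↔ r x y := fun x y => Quotient.eq
  have hG : ColorTree.Equitable G (Quotient.mk s) := by
    intro v w hvw c
    induction c using Quotient.inductionOn with
    | h u₀ => simpa [hcol] using hstable v w ((hcol v w).1 hvw) u₀ () ()
  refine hex (hG.hasTopologicalSubgraph hh ht
    (fun x hx y hy => ColorTree.exists_walk_of_connectedComponent comp hx hy) ?_
    (f := fun i => (f i : V)) (fun i j hij => f.injective (Subtype.ext hij))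
    (fun i w hw => hDsingle _ (hfD i) w (hequiv.symm ((hcol _ _).1 hw))) fun i => (f i).2.2)
  rintro _ ⟨z, -, rfl⟩
  by_contra hle
  rw [not_lt] at hle
  refine z.2 ⟨r, ⟨hequiv, hstable, hdisc, hinit, hcoarse⟩, hdisc z ?_⟩
  refine le_of_eq_of_le ?_ hle
  rw [← Set.ncard_coe_finset]
  congr 1
  ext w
  simp only [Set.mem_ofPred_eq, SetLike.mem_coe, ColorTree.mem_fiber, hcol]
  exact ⟨hequiv.symm, hequiv.symm⟩
end
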